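/- For every set of finite perimeter E ⊆ (0,1)^d, the relative perimeter satisfies Per(E, (0,1)^d) ≥ √(2π) · I_γ(|E|), where I_γ = φ ∘ Φ⁻¹ is the Gaussian isoperimetric profile and |E| is the Lebesgue measure of E. -/

import Mathlib

open MeasureTheory Real
open scoped RealInnerProductSpace MeasureTheory ENNReal symmDiff

noncomputable section

/-- The one-dimensional standard Gaussian density `φ(t) = (2π)^{-1/2} exp(-t²/2)`. -/
def gaussPdf (t : ℝ) : ℝ := (Real.sqrt (2 * Real.pi))⁻¹ * Real.exp (-t ^ 2 / 2)

/-- The `d`-dimensional standard Gaussian density `φ_d(x) = (2π)^{-d/2} exp(-|x|²/2)`. -/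
def gaussPdfD (d : ℕ) (x : EuclideanSpace ℝ (Fin d)) : ℝ :=
  (2 * Real.pi) ^ (-(d : ℝ) / 2) * Real.exp (-‖x‖ ^ 2 / 2)

/-- The standard Gaussian measure `γ_d` on `ℝ^d`. -/
def gaussMeasure (d : ℕ) : Measure (EuclideanSpace ℝ (Fin d)) :=
  volume.withDensity fun x => ENNReal.ofReal (gaussPdfD d x)

/-- The Gaussian-weighted `(d-1)`-dimensional Hausdorff measure `H^{d-1}_{γ_d} = φ_d · H^{d-1}`. -/
def gaussHaus (d : ℕ) : Measure (EuclideanSpace ℝ (Fin d)) :=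
  (μH[(d : ℝ) - 1]).withDensity fun x => ENNReal.ofReal (gaussPdfD d x)

/-- The open unit cube `(0,1)^d`. -/
def unitCube (d : ℕ) : Set (EuclideanSpace ℝ (Fin d)) :=
  {x | ∀ i, x i ∈ Set.Ioo (0 : ℝ) 1}

/-- The relative perimeter `Per(E, Ω)`: the total variation of the distributional gradient of
the indicator of `E` in `Ω`, i.e. the supremum of `∫_E div X` over `C¹` vector fields `X`
compactly supported in `Ω` with `‖X‖ ≤ 1`. -/
def relPerimeter (d : ℕ) (E Ω : Set (EuclideanSpace ℝ (Fin d))) : ℝ≥0∞ :=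
  ⨆ (X : EuclideanSpace ℝ (Fin d) → EuclideanSpace ℝ (Fin d)) (_ : ContDiff ℝ 1 X)
    (_ : HasCompactSupport X) (_ : tsupport X ⊆ Ω) (_ : ∀ x, ‖X x‖ ≤ 1),
    ENNReal.ofReal (∫ x in E, ∑ i, fderiv ℝ X x (EuclideanSpace.single i 1) i)

/-- The one-dimensional standard Gaussian CDF `Φ`. -/
def gaussCdf (t : ℝ) : ℝ := ∫ s in Set.Iic t, gaussPdf s

/-- The Gaussian isoperimetric profile `I_γ = φ ∘ Φ⁻¹`, extended by `0` outside `(0,1)`. -/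
def gaussIsopProfile (l : ℝ) : ℝ :=
  if l ≤ 0 ∨ 1 ≤ l then 0 else gaussPdf (Function.invFun gaussCdf l)

/-- The relative isoperimetric profile of the unit cube `(0,1)^d`. -/
def cubeIsopProfile (d : ℕ) (l : ℝ) : ℝ≥0∞ :=
  ⨅ (E : Set (EuclideanSpace ℝ (Fin d))) (_ : MeasurableSet E) (_ : E ⊆ unitCube d)
    (_ : volume E = ENNReal.ofReal l), relPerimeter d E (unitCube d)

/-- The measure-theoretic (essential) boundary of a set: points where the volume density of `E`
neither tends to `0` nor to `1`; for a set of finite perimeter it carries the same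
`H^{d-1}`-measure as the reduced boundary `∂*E`. -/
def essBoundary (d : ℕ) (E : Set (EuclideanSpace ℝ (Fin d))) : Set (EuclideanSpace ℝ (Fin d)) :=
  {x | ¬ Filter.Tendsto (fun r : ℝ => volume (E ∩ Metric.ball x r) / volume (Metric.ball x r))
        (nhdsWithin 0 (Set.Ioi 0)) (nhds 0) ∧
       ¬ Filter.Tendsto (fun r : ℝ => volume (E ∩ Metric.ball x r) / volume (Metric.ball x r))
        (nhdsWithin 0 (Set.Ioi 0)) (nhds 1)}

end

open Set Filter Topology ProbabilityTheory

section GaussianProfile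

theorem gaussPdf_eq_gaussianPDFReal (t : ℝ) : gaussPdf t = gaussianPDFReal 0 1 t := by
  simp [gaussPdf, gaussianPDFReal_def]

theorem gaussPdf_pos (t : ℝ) : 0 < gaussPdf t := by
  unfold gaussPdf; positivity

theorem gaussPdf_neg (t : ℝ) : gaussPdf (-t) = gaussPdf t := by
  simp [gaussPdf]

theorem hasDerivAt_gaussPdf (t : ℝ) : HasDerivAt gaussPdf (-t * gaussPdf t) t := by
  unfold gaussPdf
  have h : HasDerivAt (fun t : ℝ => -t ^ 2 / 2) (-t) t :=
    ((hasDerivAt_pow 2 t).neg.div_const 2).congr_deriv (by push_cast; ring)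
  exact (h.exp.const_mul (√(2 * π))⁻¹).congr_deriv (by ring)

theorem continuous_gaussPdf : Continuous gaussPdf := by
  unfold gaussPdf; fun_prop

theorem integrable_gaussPdf : Integrable gaussPdf := by
  have : gaussPdf = gaussianPDFReal 0 1 := funext gaussPdf_eq_gaussianPDFReal
  rw [this]; exact integrable_gaussianPDFReal 0 1

theorem integral_gaussPdf : ∫ t, gaussPdf t = 1 := by
  simp_rw [gaussPdf_eq_gaussianPDFReal]
  exact integral_gaussianPDFReal_eq_one 0 one_ne_zero

theorem gaussPdf_le (t : ℝ) : gaussPdf t ≤ (√(2 * π))⁻¹ := by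
  unfold gaussPdf
  have : rexp (-t ^ 2 / 2) ≤ 1 := Real.exp_le_one_iff.2 (by nlinarith [sq_nonneg t])
  nlinarith [show 0 ≤ (√(2 * π))⁻¹ by positivity]

theorem gaussPdf_le_one (t : ℝ) : gaussPdf t ≤ 1 := by
  refine (gaussPdf_le t).trans (inv_le_one_of_one_le₀ ?_)
  rw [Real.one_le_sqrt]
  linarith [Real.pi_gt_three]

theorem tendsto_gaussPdf_atTop : Tendsto gaussPdf atTop (𝓝 0) := by
  unfold gaussPdf
  rw [← mul_zero (√(2 * π))⁻¹]
  refine Tendsto.const_mul _ (Real.tendsto_exp_atBot.comp ?_)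
  have : Tendsto (fun t : ℝ => t ^ 2 / 2) atTop atTop :=
    (tendsto_pow_atTop two_ne_zero).atTop_div_const two_pos
  refine (tendsto_neg_atTop_atBot.comp this).congr fun t => ?_
  simp [neg_div]

theorem gaussCdf_eq_cdf (t : ℝ) : gaussCdf t = cdf (gaussianReal 0 1) t := by
  rw [cdf_eq_real, measureReal_def, gaussianReal_apply_eq_integral 0 one_ne_zero,
    ENNReal.toReal_ofReal (integral_nonneg fun x => gaussianPDFReal_nonneg 0 1 x), gaussCdf]
  simp_rw [gaussPdf_eq_gaussianPDFReal]

theorem hasDerivAt_gaussCdf (t : ℝ) : HasDerivAt gaussCdf (gaussPdf t) t := by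
  have h : gaussCdf = fun t => gaussCdf 0 + ∫ s in (0 : ℝ)..t, gaussPdf s := by
    ext t
    rw [← intervalIntegral.integral_Iic_sub_Iic integrable_gaussPdf.integrableOn
      integrable_gaussPdf.integrableOn]
    simp [gaussCdf]
  rw [h]
  exact (continuous_gaussPdf.integral_hasStrictDerivAt 0 t).hasDerivAt.const_add _

theorem continuous_gaussCdf : Continuous gaussCdf :=
  continuous_iff_continuousAt.2 fun t => (hasDerivAt_gaussCdf t).continuousAt

theorem strictMono_gaussCdf : StrictMono gaussCdf :=
  strictMono_of_hasDerivAt_pos hasDerivAt_gaussCdf gaussPdf_pos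

theorem tendsto_gaussCdf_atBot : Tendsto gaussCdf atBot (𝓝 0) :=
  (tendsto_cdf_atBot (gaussianReal 0 1)).congr fun t => (gaussCdf_eq_cdf t).symm

theorem tendsto_gaussCdf_atTop : Tendsto gaussCdf atTop (𝓝 1) :=
  (tendsto_cdf_atTop (gaussianReal 0 1)).congr fun t => (gaussCdf_eq_cdf t).symm

theorem gaussCdf_mem_Ioo (t : ℝ) : gaussCdf t ∈ Ioo (0 : ℝ) 1 := by
  constructor
  · refine lt_of_le_of_lt ?_ (strictMono_gaussCdf (sub_one_lt t))
    rw [gaussCdf_eq_cdf]; exact cdf_nonneg _ _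
  · refine lt_of_lt_of_le (strictMono_gaussCdf (lt_add_one t)) ?_
    rw [gaussCdf_eq_cdf]; exact cdf_le_one _ _

theorem range_gaussCdf : range gaussCdf = Ioo (0 : ℝ) 1 := by
  refine subset_antisymm (range_subset_iff.2 gaussCdf_mem_Ioo) fun p hp => ?_
  obtain ⟨a, ha⟩ := (tendsto_gaussCdf_atBot.eventually (gt_mem_nhds hp.1)).exists
  obtain ⟨b, hb⟩ := (tendsto_gaussCdf_atTop.eventually (lt_mem_nhds hp.2)).exists
  exact mem_range_of_exists_le_of_exists_ge continuous_gaussCdf ⟨a, ha.le⟩ ⟨b, hb.le⟩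

theorem gaussCdf_neg (t : ℝ) : gaussCdf (-t) = 1 - gaussCdf t := by
  have h1 : gaussCdf (-t) = ∫ s in Ioi t, gaussPdf s := by
    have := integral_comp_neg_Iic (-t) gaussPdf
    simp only [gaussPdf_neg, neg_neg] at this
    exact this
  have h2 := integral_add_compl (measurableSet_Iic (a := t)) integrable_gaussPdf
  rw [integral_gaussPdf, compl_Iic] at h2
  rw [h1, ← h2, gaussCdf]; ring

/-- The quantile function of the standard Gaussian, with junk values outside `(0, 1)`. -/
noncomputable def gaussQuantile (p : ℝ) : ℝ := Function.invFun gaussCdf p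

theorem gaussQuantile_gaussCdf (t : ℝ) : gaussQuantile (gaussCdf t) = t :=
  Function.leftInverse_invFun strictMono_gaussCdf.injective t

theorem gaussCdf_gaussQuantile {p : ℝ} (hp : p ∈ Ioo (0 : ℝ) 1) :
    gaussCdf (gaussQuantile p) = p :=
  Function.invFun_eq (show p ∈ range gaussCdf by rwa [range_gaussCdf])

theorem gaussQuantile_lt_iff {p q : ℝ} (hp : p ∈ Ioo (0 : ℝ) 1) (hq : q ∈ Ioo (0 : ℝ) 1) :
    gaussQuantile p < gaussQuantile q ↔ p < q := by
  rw [← strictMono_gaussCdf.lt_iff_lt, gaussCdf_gaussQuantile hp, gaussCdf_gaussQuantile hq]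

theorem gaussQuantile_le_iff {p q : ℝ} (hp : p ∈ Ioo (0 : ℝ) 1) (hq : q ∈ Ioo (0 : ℝ) 1) :
    gaussQuantile p ≤ gaussQuantile q ↔ p ≤ q := by
  rw [← strictMono_gaussCdf.le_iff_le, gaussCdf_gaussQuantile hp, gaussCdf_gaussQuantile hq]

theorem gaussQuantile_one_sub {p : ℝ} (hp : p ∈ Ioo (0 : ℝ) 1) :
    gaussQuantile (1 - p) = -gaussQuantile p := by
  rw [← gaussQuantile_gaussCdf (-gaussQuantile p), gaussCdf_neg, gaussCdf_gaussQuantile hp]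

theorem continuousAt_gaussQuantile {p : ℝ} (hp : p ∈ Ioo (0 : ℝ) 1) :
    ContinuousAt gaussQuantile p := by
  refine StrictMonoOn.continuousAt_of_image_mem_nhds (s := Ioo 0 1)
    (fun a ha b hb hab => (gaussQuantile_lt_iff ha hb).2 hab) (Ioo_mem_nhds hp.1 hp.2) ?_
  convert univ_mem
  exact eq_univ_of_forall fun t => ⟨_, gaussCdf_mem_Ioo t, gaussQuantile_gaussCdf t⟩

theorem hasDerivAt_gaussQuantile {p : ℝ} (hp : p ∈ Ioo (0 : ℝ) 1) :
    HasDerivAt gaussQuantile (gaussPdf (gaussQuantile p))⁻¹ p := by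
  refine HasDerivAt.of_local_left_inverse (continuousAt_gaussQuantile hp)
    (hasDerivAt_gaussCdf _) (gaussPdf_pos _).ne' ?_
  filter_upwards [Ioo_mem_nhds hp.1 hp.2] with q hq using gaussCdf_gaussQuantile hq

theorem gaussIsopProfile_of_mem {p : ℝ} (hp : p ∈ Ioo (0 : ℝ) 1) :
    gaussIsopProfile p = gaussPdf (gaussQuantile p) := by
  simp [gaussIsopProfile, gaussQuantile, not_le.2 hp.1, not_le.2 hp.2]

theorem gaussIsopProfile_of_notMem {p : ℝ} (hp : p ∉ Ioo (0 : ℝ) 1) :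
    gaussIsopProfile p = 0 := by
  rw [gaussIsopProfile, if_pos]
  by_contra h
  push Not at h
  exact hp h

theorem gaussIsopProfile_pos {p : ℝ} (hp : p ∈ Ioo (0 : ℝ) 1) : 0 < gaussIsopProfile p := by
  rw [gaussIsopProfile_of_mem hp]; exact gaussPdf_pos _

theorem gaussIsopProfile_nonneg (p : ℝ) : 0 ≤ gaussIsopProfile p := by
  by_cases hp : p ∈ Ioo (0 : ℝ) 1
  · exact (gaussIsopProfile_pos hp).le
  · rw [gaussIsopProfile_of_notMem hp]

theorem gaussIsopProfile_le_one (p : ℝ) : gaussIsopProfile p ≤ 1 := by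
  by_cases hp : p ∈ Ioo (0 : ℝ) 1
  · rw [gaussIsopProfile_of_mem hp]; exact gaussPdf_le_one _
  · rw [gaussIsopProfile_of_notMem hp]; exact zero_le_one

theorem gaussIsopProfile_one_sub (p : ℝ) : gaussIsopProfile (1 - p) = gaussIsopProfile p := by
  by_cases hp : p ∈ Ioo (0 : ℝ) 1
  · have hq : 1 - p ∈ Ioo (0 : ℝ) 1 := ⟨by linarith [hp.2], by linarith [hp.1]⟩
    rw [gaussIsopProfile_of_mem hp, gaussIsopProfile_of_mem hq, gaussQuantile_one_sub hp,
      gaussPdf_neg]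
  · have hq : 1 - p ∉ Ioo (0 : ℝ) 1 := fun h => hp ⟨by linarith [h.2], by linarith [h.1]⟩
    rw [gaussIsopProfile_of_notMem hp, gaussIsopProfile_of_notMem hq]

theorem hasDerivAt_gaussIsopProfile {p : ℝ} (hp : p ∈ Ioo (0 : ℝ) 1) :
    HasDerivAt gaussIsopProfile (-gaussQuantile p) p := by
  have h := (hasDerivAt_gaussPdf (gaussQuantile p)).comp p (hasDerivAt_gaussQuantile hp)
  rw [mul_assoc, mul_inv_cancel₀ (gaussPdf_pos _).ne', mul_one] at h
  refine h.congr_of_eventuallyEq ?_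
  filter_upwards [Ioo_mem_nhds hp.1 hp.2] with q hq using gaussIsopProfile_of_mem hq

theorem gaussIsopProfile_le_of_le {p q : ℝ} (hpq : p ≤ q) (hq : q ≤ 1 / 2) :
    gaussIsopProfile p ≤ gaussIsopProfile q := by
  by_cases hp : p ∈ Ioo (0 : ℝ) 1
  · have hq' : q ∈ Ioo (0 : ℝ) 1 := ⟨hp.1.trans_le hpq, by linarith⟩
    have hs : gaussQuantile q ≤ 0 := by
      have h1 : 1 - q ∈ Ioo (0 : ℝ) 1 := ⟨by linarith, by linarith [hq'.1]⟩
      have := (gaussQuantile_le_iff hq' h1).2 (by linarith)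
      rw [gaussQuantile_one_sub hq'] at this
      linarith
    have hle := (gaussQuantile_le_iff hp hq').2 hpq
    rw [gaussIsopProfile_of_mem hp, gaussIsopProfile_of_mem hq', gaussPdf, gaussPdf]
    gcongr ?_ * rexp ?_
    nlinarith
  · rw [gaussIsopProfile_of_notMem hp]; exact gaussIsopProfile_nonneg q

theorem continuousAt_gaussIsopProfile_zero : ContinuousAt gaussIsopProfile 0 := by
  rw [ContinuousAt, gaussIsopProfile_of_notMem (by simp : (0 : ℝ) ∉ Ioo 0 1), Metric.tendsto_nhds]
  intro ε hε
  obtain ⟨T, hT, hT0⟩ := ((tendsto_gaussPdf_atTop.eventually (gt_mem_nhds hε)).and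
    (eventually_ge_atTop 0)).exists
  have h0 := gaussCdf_mem_Ioo (-T)
  have hhalf : gaussCdf (-T) ≤ 1 / 2 := by
    have h1 := strictMono_gaussCdf.monotone (show -T ≤ 0 by linarith)
    have h2 := gaussCdf_neg 0
    rw [neg_zero] at h2
    linarith
  filter_upwards [gt_mem_nhds h0.1] with p hp
  rw [Real.dist_eq, sub_zero, abs_of_nonneg (gaussIsopProfile_nonneg p)]
  refine (gaussIsopProfile_le_of_le hp.le hhalf).trans_lt ?_
  rwa [gaussIsopProfile_of_mem h0, gaussQuantile_gaussCdf, gaussPdf_neg]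

theorem continuous_gaussIsopProfile : Continuous gaussIsopProfile := by
  have hlow : ∀ p ≤ 0, ContinuousAt gaussIsopProfile p := by
    intro p hp
    rcases hp.lt_or_eq with hp | rfl
    · refine continuousAt_const.congr (f := fun _ => (0 : ℝ)) ?_
      filter_upwards [gt_mem_nhds hp] with q hq
      exact (gaussIsopProfile_of_notMem fun h => (h.1.trans hq).false).symm
    · exact continuousAt_gaussIsopProfile_zero
  refine continuous_iff_continuousAt.2 fun p => ?_
  by_cases hp : p ∈ Ioo (0 : ℝ) 1
  · exact (hasDerivAt_gaussIsopProfile hp).continuousAt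
  rcases le_or_gt p 0 with h | h
  · exact hlow p h
  · have hp1 : 1 - p ≤ 0 := by
      by_contra! h'
      exact hp ⟨h, by linarith⟩
    have := ContinuousAt.comp (f := fun q : ℝ => 1 - q) (x := p) (hlow _ hp1) (by fun_prop)
    exact this.congr (Eventually.of_forall fun q => gaussIsopProfile_one_sub q)

end GaussianProfile

section TwoPoint

theorem nonneg_of_hasDerivAt_nonneg {f f' : ℝ → ℝ} {x : ℝ} (hx : 0 ≤ x) (h0 : f 0 = 0)
    (hf : ∀ t ∈ Icc 0 x, HasDerivAt f (f' t) t) (hf' : ∀ t ∈ Icc 0 x, 0 ≤ f' t) : 0 ≤ f x := by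
  have hmono : MonotoneOn f (Icc 0 x) := by
    refine monotoneOn_of_deriv_nonneg (convex_Icc 0 x)
      (fun t ht => (hf t ht).continuousAt.continuousWithinAt) ?_ ?_
    · intro t ht
      exact (hf t (interior_subset ht)).differentiableAt.differentiableWithinAt
    · intro t ht
      rw [(hf t (interior_subset ht)).deriv]
      exact hf' t (interior_subset ht)
  rw [← h0]
  exact hmono (left_mem_Icc.2 hx) (right_mem_Icc.2 hx) hx

theorem hasDerivAt_gaussIsopProfile_sq {p : ℝ} (hp : p ∈ Ioo (0 : ℝ) 1) :
    HasDerivAt (fun p => gaussIsopProfile p ^ 2) (-2 * (gaussIsopProfile p * gaussQuantile p)) p :=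
  ((hasDerivAt_gaussIsopProfile hp).pow 2).congr_deriv (by push_cast; ring)

theorem hasDerivAt_gaussIsopProfile_mul_gaussQuantile {p : ℝ} (hp : p ∈ Ioo (0 : ℝ) 1) :
    HasDerivAt (fun p => gaussIsopProfile p * gaussQuantile p) (1 - gaussQuantile p ^ 2) p := by
  refine ((hasDerivAt_gaussIsopProfile hp).mul (hasDerivAt_gaussQuantile hp)).congr_deriv ?_
  rw [gaussIsopProfile_of_mem hp, mul_inv_cancel₀ (gaussPdf_pos _).ne']
  ring

theorem monotone_div_gaussPdf : Monotone fun s => s / gaussPdf s := by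
  refine monotone_of_hasDerivAt_nonneg (f' := fun s => (1 + s ^ 2) / gaussPdf s) (fun s => ?_)
    fun s => div_nonneg (by positivity) (gaussPdf_pos s).le
  refine ((hasDerivAt_id s).div (hasDerivAt_gaussPdf s) (gaussPdf_pos s).ne').congr_deriv ?_
  have := (gaussPdf_pos s).ne'
  simp only [id]
  field_simp
  ring

theorem sq_gaussQuantile_add_le {c t : ℝ} (hc : c ≤ 1 / 2) (ht : 0 ≤ t) (hct : 0 < c - t) :
    gaussQuantile (c + t) ^ 2 ≤ gaussQuantile (c - t) ^ 2 := by
  have h1 : c - t ∈ Ioo (0 : ℝ) 1 := ⟨hct, by linarith⟩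
  have h2 : c + t ∈ Ioo (0 : ℝ) 1 := ⟨by linarith, by linarith⟩
  have h3 : 1 - (c - t) ∈ Ioo (0 : ℝ) 1 := ⟨by linarith, by linarith⟩
  have h4 := (gaussQuantile_le_iff h1 h2).2 (by linarith)
  have h5 := (gaussQuantile_le_iff h2 h3).2 (by linarith)
  rw [gaussQuantile_one_sub h1] at h5
  nlinarith

theorem sq_gaussIsopProfile_sub_le {c x : ℝ} (hc : c ≤ 1 / 2) (hx : 0 ≤ x) (hcx : 0 < c - x) :
    gaussIsopProfile (c + x) ^ 2 - gaussIsopProfile (c - x) ^ 2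
      ≤ -4 * (gaussIsopProfile c * gaussQuantile c) * x := by
  have hp : ∀ t ∈ Icc 0 x, c + t ∈ Ioo (0 : ℝ) 1 := fun t ht =>
    ⟨by linarith [ht.1], by linarith [ht.2]⟩
  have hm : ∀ t ∈ Icc 0 x, c - t ∈ Ioo (0 : ℝ) 1 := fun t ht =>
    ⟨by linarith [ht.2], by linarith [ht.1]⟩
  have key := nonneg_of_hasDerivAt_nonneg hx
    (f := fun t => -4 * (gaussIsopProfile c * gaussQuantile c) * t -
      (gaussIsopProfile (c + t) ^ 2 - gaussIsopProfile (c - t) ^ 2))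
    (f' := fun t => -4 * (gaussIsopProfile c * gaussQuantile c) +
      2 * (gaussIsopProfile (c + t) * gaussQuantile (c + t)) +
      2 * (gaussIsopProfile (c - t) * gaussQuantile (c - t)))
    (by simp)
    (fun t ht => by
      refine (((hasDerivAt_id t).const_mul _).sub
        (((hasDerivAt_gaussIsopProfile_sq (hp t ht)).comp_const_add _ _).sub
          ((hasDerivAt_gaussIsopProfile_sq (hm t ht)).comp_const_sub _ _))).congr_deriv ?_
      ring)
    (fun t ht => by
      refine nonneg_of_hasDerivAt_nonneg ht.1
        (f' := fun s => 2 * (gaussQuantile (c - s) ^ 2 - gaussQuantile (c + s) ^ 2))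
        (f := fun t => -4 * (gaussIsopProfile c * gaussQuantile c) +
          2 * (gaussIsopProfile (c + t) * gaussQuantile (c + t)) +
          2 * (gaussIsopProfile (c - t) * gaussQuantile (c - t)))
        (by simp; ring) (fun s hs => ?_) (fun s hs => ?_)
      · have hs' : s ∈ Icc 0 x := ⟨hs.1, hs.2.trans ht.2⟩
        refine (((((hasDerivAt_gaussIsopProfile_mul_gaussQuantile
          (hp s hs')).comp_const_add _ _).const_mul 2).const_add _).add
          (((hasDerivAt_gaussIsopProfile_mul_gaussQuantile
          (hm s hs')).comp_const_sub _ _).const_mul 2)).congr_deriv ?_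
        ring
      · have := sq_gaussQuantile_add_le hc hs.1 (by linarith [hs.2, ht.2])
        linarith)
  simpa using key

theorem le_sq_gaussIsopProfile_add {c x : ℝ} (hc : c ≤ 1 / 2) (hx : 0 ≤ x) (hcx : 0 < c - x) :
    2 * gaussQuantile c ^ 2 * x ^ 2 ≤ gaussIsopProfile (c + x) ^ 2 +
      gaussIsopProfile (c - x) ^ 2 - 2 * gaussIsopProfile c ^ 2 + 2 * x ^ 2 := by
  have hp : ∀ t ∈ Icc 0 x, c + t ∈ Ioo (0 : ℝ) 1 := fun t ht =>
    ⟨by linarith [ht.1], by linarith [ht.2]⟩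
  have hm : ∀ t ∈ Icc 0 x, c - t ∈ Ioo (0 : ℝ) 1 := fun t ht =>
    ⟨by linarith [ht.2], by linarith [ht.1]⟩
  have hconv : ∀ t ∈ Icc 0 x,
      0 ≤ gaussQuantile (c + t) ^ 2 + gaussQuantile (c - t) ^ 2 - 2 * gaussQuantile c ^ 2 := by
    intro t ht
    refine nonneg_of_hasDerivAt_nonneg ht.1
      (f' := fun s => 2 * (gaussQuantile (c + s) / gaussPdf (gaussQuantile (c + s)) -
        gaussQuantile (c - s) / gaussPdf (gaussQuantile (c - s))))
      (f := fun t => gaussQuantile (c + t) ^ 2 + gaussQuantile (c - t) ^ 2 -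
        2 * gaussQuantile c ^ 2) (by simp; ring) (fun s hs => ?_) (fun s hs => ?_)
    all_goals have hs' : s ∈ Icc 0 x := ⟨hs.1, hs.2.trans ht.2⟩
    · refine (((((hasDerivAt_gaussQuantile (hp s hs')).comp_const_add _ _).pow 2).add
        (((hasDerivAt_gaussQuantile (hm s hs')).comp_const_sub _ _).pow 2)).sub_const
        _).congr_deriv ?_
      push_cast
      ring
    · have := monotone_div_gaussPdf ((gaussQuantile_le_iff (hm s hs') (hp s hs')).2
        (by linarith [hs.1]))
      simp only at this
      linarith
  have hderiv : ∀ t ∈ Icc 0 x, 0 ≤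
      -2 * (gaussIsopProfile (c + t) * gaussQuantile (c + t)) +
      2 * (gaussIsopProfile (c - t) * gaussQuantile (c - t)) + 4 * t -
      4 * gaussQuantile c ^ 2 * t := by
    intro t ht
    refine nonneg_of_hasDerivAt_nonneg ht.1
      (f' := fun s => 2 * (gaussQuantile (c + s) ^ 2 + gaussQuantile (c - s) ^ 2 -
        2 * gaussQuantile c ^ 2))
      (f := fun t => -2 * (gaussIsopProfile (c + t) * gaussQuantile (c + t)) +
        2 * (gaussIsopProfile (c - t) * gaussQuantile (c - t)) + 4 * t -
        4 * gaussQuantile c ^ 2 * t) (by simp) (fun s hs => ?_) (fun s hs => ?_)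
    all_goals have hs' : s ∈ Icc 0 x := ⟨hs.1, hs.2.trans ht.2⟩
    · refine ((((((hasDerivAt_gaussIsopProfile_mul_gaussQuantile
        (hp s hs')).comp_const_add _ _).const_mul (-2)).add
        (((hasDerivAt_gaussIsopProfile_mul_gaussQuantile
        (hm s hs')).comp_const_sub _ _).const_mul 2)).add ((hasDerivAt_id s).const_mul 4)).sub
        ((hasDerivAt_id s).const_mul _)).congr_deriv ?_
      ring
    · exact mul_nonneg two_pos.le (hconv s hs')
  have key := nonneg_of_hasDerivAt_nonneg hx
    (f := fun t => gaussIsopProfile (c + t) ^ 2 + gaussIsopProfile (c - t) ^ 2 -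
      2 * gaussIsopProfile c ^ 2 + 2 * t ^ 2 - 2 * gaussQuantile c ^ 2 * t ^ 2)
    (by simp; ring)
    (fun t ht => by
      refine ((((((hasDerivAt_gaussIsopProfile_sq (hp t ht)).comp_const_add _ _).add
        ((hasDerivAt_gaussIsopProfile_sq (hm t ht)).comp_const_sub _ _)).sub_const _).add
        (((hasDerivAt_id t).pow 2).const_mul 2)).sub
        (((hasDerivAt_id t).pow 2).const_mul _)).congr_deriv ?_
      simp only [id]
      push_cast
      ring)
    hderiv
  linarith

theorem two_mul_le_sqrt_add_sqrt {a g h : ℝ} (hg : 0 ≤ g) (hh : 0 ≤ h)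
    (H : (g - h) ^ 2 ≤ 8 * a ^ 2 * (g + h - 2 * a ^ 2)) : 2 * a ≤ √g + √h := by
  obtain ⟨s, hs, rfl⟩ : ∃ s, 0 ≤ s ∧ s ^ 2 = g := ⟨√g, Real.sqrt_nonneg g, Real.sq_sqrt hg⟩
  obtain ⟨t, ht, rfl⟩ : ∃ t, 0 ≤ t ∧ t ^ 2 = h := ⟨√h, Real.sqrt_nonneg h, Real.sq_sqrt hh⟩
  rw [Real.sqrt_sq hs, Real.sqrt_sq ht]
  by_contra! hlt
  have h1 : (s + t) ^ 2 < 4 * a ^ 2 := by nlinarith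
  have h2 : (s - t) ^ 2 ≤ (s + t) ^ 2 := by nlinarith
  have h3 : ((s + t) ^ 2 - 4 * a ^ 2) * ((s - t) ^ 2 - 4 * a ^ 2) ≤ 0 := by nlinarith
  nlinarith

/-- **Bobkov's two-point inequality**, for a midpoint in the lower half of `(0, 1)`. -/
theorem two_mul_gaussIsopProfile_le_of_le_half {c x : ℝ} (hc : c ≤ 1 / 2) (hx : 0 ≤ x)
    (hcx : 0 < c - x) : 2 * gaussIsopProfile c ≤
      √(gaussIsopProfile (c + x) ^ 2 + x ^ 2) + √(gaussIsopProfile (c - x) ^ 2 + x ^ 2) := by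
  refine two_mul_le_sqrt_add_sqrt (by positivity) (by positivity) ?_
  have h1 := sq_gaussIsopProfile_sub_le hc hx hcx
  have h2 := le_sq_gaussIsopProfile_add hc hx hcx
  have h3 : gaussIsopProfile (c - x) ^ 2 ≤ gaussIsopProfile (c + x) ^ 2 := by
    refine pow_le_pow_left₀ (gaussIsopProfile_nonneg _) ?_ 2
    rw [gaussIsopProfile_of_mem (show c - x ∈ Ioo (0 : ℝ) 1 from ⟨hcx, by linarith⟩),
      gaussIsopProfile_of_mem (show c + x ∈ Ioo (0 : ℝ) 1 from ⟨by linarith, by linarith⟩),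
      gaussPdf, gaussPdf]
    have := sq_gaussQuantile_add_le hc hx hcx
    gcongr
  have h4 : (gaussIsopProfile (c + x) ^ 2 - gaussIsopProfile (c - x) ^ 2) ^ 2 ≤
      (-4 * (gaussIsopProfile c * gaussQuantile c) * x) ^ 2 :=
    pow_le_pow_left₀ (by linarith) h1 2
  have h5 := mul_le_mul_of_nonneg_left h2 (show 0 ≤ 8 * gaussIsopProfile c ^ 2 by positivity)
  calc _ = (gaussIsopProfile (c + x) ^ 2 - gaussIsopProfile (c - x) ^ 2) ^ 2 := by ring
    _ ≤ _ := h4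
    _ = 8 * gaussIsopProfile c ^ 2 * (2 * gaussQuantile c ^ 2 * x ^ 2) := by ring
    _ ≤ _ := h5
    _ = _ := by ring

/-- **Bobkov's two-point inequality**. -/
theorem gaussIsopProfile_midpoint_le {a b : ℝ} (ha : a ∈ Ioo (0 : ℝ) 1) (hb : b ∈ Ioo (0 : ℝ) 1) :
    gaussIsopProfile ((a + b) / 2) ≤
      (√(gaussIsopProfile a ^ 2 + ((a - b) / 2) ^ 2) +
        √(gaussIsopProfile b ^ 2 + ((a - b) / 2) ^ 2)) / 2 := by
  wlog hab : b ≤ a generalizing a b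
  · have := this hb ha (le_of_not_ge hab)
    rw [add_comm b a, show ((b - a) / 2) ^ 2 = ((a - b) / 2) ^ 2 by ring] at this
    linarith
  wlog hc : (a + b) / 2 ≤ 1 / 2 generalizing a b
  · have := this (a := 1 - b) (b := 1 - a) ⟨by linarith [hb.2], by linarith [hb.1]⟩
      ⟨by linarith [ha.2], by linarith [ha.1]⟩ (by linarith) (by linarith)
    rw [show (1 - b + (1 - a)) / 2 = 1 - (a + b) / 2 by ring,
      show (1 - b - (1 - a)) / 2 = (a - b) / 2 by ring] at this
    simp only [gaussIsopProfile_one_sub] at this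
    linarith
  have := two_mul_gaussIsopProfile_le_of_le_half hc (show 0 ≤ (a - b) / 2 by linarith)
    (by linarith [hb.1])
  rw [show (a + b) / 2 + (a - b) / 2 = a by ring,
    show (a + b) / 2 - (a - b) / 2 = b by ring] at this
  linarith

end TwoPoint

section RandomWalk

theorem sqrt_sq_average_le (a b c d : ℝ) :
    √(((a + b) / 2) ^ 2 + ((c + d) / 2) ^ 2) ≤ (√(a ^ 2 + c ^ 2) + √(b ^ 2 + d ^ 2)) / 2 := by
  have hP := Real.sqrt_nonneg (a ^ 2 + c ^ 2)
  have hQ := Real.sqrt_nonneg (b ^ 2 + d ^ 2)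
  have hP2 := Real.sq_sqrt (show 0 ≤ a ^ 2 + c ^ 2 by positivity)
  have hQ2 := Real.sq_sqrt (show 0 ≤ b ^ 2 + d ^ 2 by positivity)
  refine Real.sqrt_le_iff.2 ⟨by positivity, ?_⟩
  have : a * b + c * d ≤ √(a ^ 2 + c ^ 2) * √(b ^ 2 + d ^ 2) := by
    refine abs_le_of_sq_le_sq' ?_ (by positivity) |>.2
    rw [mul_pow, hP2, hQ2]
    nlinarith [sq_nonneg (a * d - b * c)]
  nlinarith

/-- Averaging over one step `±h` of the symmetric random walk. -/
noncomputable def walkAvg (h : ℝ) (F : ℝ → ℝ) (x : ℝ) : ℝ := (F (x + h) + F (x - h)) / 2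

theorem iterate_walkAvg_mono (h : ℝ) (n : ℕ) {F G : ℝ → ℝ} (hFG : F ≤ G) :
    (walkAvg h)^[n] F ≤ (walkAvg h)^[n] G := by
  refine Monotone.iterate (fun F G hFG x => ?_) n hFG
  have h1 := hFG (x + h)
  have h2 := hFG (x - h)
  unfold walkAvg
  linarith

/-- **Bobkov's inequality** for functions of the position of a symmetric random walk. -/
theorem gaussIsopProfile_iterate_walkAvg_le (h : ℝ) (n : ℕ) {f M : ℝ → ℝ}
    (hf : ∀ x, f x ∈ Ioo (0 : ℝ) 1) (hM : ∀ x, 0 ≤ M x)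
    (hfM : ∀ x, |f (x + 2 * h) - f x| ≤ 2 * h * M x ∧ |f (x - 2 * h) - f x| ≤ 2 * h * M x)
    (x : ℝ) :
    gaussIsopProfile ((walkAvg h)^[n] f x) ≤
      (walkAvg h)^[n] (fun y => √(gaussIsopProfile (f y) ^ 2 + n * (h * M y) ^ 2)) x := by
  induction n generalizing f M with
  | zero => simp [Real.sqrt_sq (gaussIsopProfile_nonneg _)]
  | succ n ih =>
    rw [Function.iterate_succ_apply, Function.iterate_succ_apply]
    refine (ih (f := walkAvg h f) (M := walkAvg h M) (fun x => ?_) (fun x => ?_)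
      (fun x => ?_)).trans (iterate_walkAvg_mono h n (fun y => ?_) x)
    · have h1 := hf (x + h)
      have h2 := hf (x - h)
      unfold walkAvg
      exact ⟨by linarith [h1.1, h2.1], by linarith [h1.2, h2.2]⟩
    · have h1 := hM (x + h)
      have h2 := hM (x - h)
      unfold walkAvg
      positivity
    · have h1 := hfM (x + h)
      have h2 := hfM (x - h)
      unfold walkAvg
      rw [show x + 2 * h + h = x + h + 2 * h by ring, show x + 2 * h - h = x - h + 2 * h by ring,
        show x - 2 * h + h = x + h - 2 * h by ring, show x - 2 * h - h = x - h - 2 * h by ring]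
      simp only [abs_le] at *
      exact ⟨⟨by linarith [h1.1.1, h2.1.1], by linarith [h1.1.2, h2.1.2]⟩,
        ⟨by linarith [h1.2.1, h2.2.1], by linarith [h1.2.2, h2.2.2]⟩⟩
    · have hp : ((f (y + h) - f (y - h)) / 2) ^ 2 ≤ (h * M (y + h)) ^ 2 := by
        have := (hfM (y + h)).2
        rw [show y + h - 2 * h = y - h by ring, abs_sub_comm] at this
        refine sq_le_sq' ?_ ?_ <;> linarith [abs_le.1 this |>.1, abs_le.1 this |>.2]
      have hm : ((f (y + h) - f (y - h)) / 2) ^ 2 ≤ (h * M (y - h)) ^ 2 := by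
        have := (hfM (y - h)).1
        rw [show y - h + 2 * h = y + h by ring] at this
        refine sq_le_sq' ?_ ?_ <;> linarith [abs_le.1 this |>.1, abs_le.1 this |>.2]
      set A := √(gaussIsopProfile (f (y + h)) ^ 2 + (h * M (y + h)) ^ 2) with hA
      set B := √(gaussIsopProfile (f (y - h)) ^ 2 + (h * M (y - h)) ^ 2) with hB
      have hAB : gaussIsopProfile (walkAvg h f y) ≤ (A + B) / 2 := by
        refine (gaussIsopProfile_midpoint_le (hf _) (hf _)).trans ?_
        rw [hA, hB]
        gcongr
      calc √(gaussIsopProfile (walkAvg h f y) ^ 2 + n * (h * walkAvg h M y) ^ 2)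
          ≤ √(((A + B) / 2) ^ 2 +
              ((√n * (h * M (y + h)) + √n * (h * M (y - h))) / 2) ^ 2) := by
            refine Real.sqrt_le_sqrt (add_le_add
              (pow_le_pow_left₀ (gaussIsopProfile_nonneg _) hAB 2) (le_of_eq ?_))
            have := Real.sq_sqrt (Nat.cast_nonneg (α := ℝ) n)
            unfold walkAvg
            linear_combination (-(h * ((M (y + h) + M (y - h)) / 2)) ^ 2) * this
        _ ≤ _ := sqrt_sq_average_le _ _ _ _
        _ = _ := by
            unfold walkAvg
            rw [hA, hB, Real.sq_sqrt (by positivity), Real.sq_sqrt (by positivity),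
              mul_pow √(n : ℝ), mul_pow √(n : ℝ), Real.sq_sqrt (Nat.cast_nonneg n)]
            push_cast
            ring_nf

/-- The Rademacher distribution. -/
noncomputable def rademacher : Measure ℝ :=
  (2⁻¹ : ℝ≥0∞) • (Measure.dirac 1 + Measure.dirac (-1))

instance : IsProbabilityMeasure rademacher := ⟨by
  simp [rademacher, ENNReal.inv_two_add_inv_two]⟩

theorem integral_rademacher {F : ℝ → ℝ} :
    ∫ y, F y ∂rademacher = (F 1 + F (-1)) / 2 := by
  rw [rademacher, integral_smul_measure, integral_add_measure]
  · simp; ring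
  · exact integrable_dirac (by simp)
  · exact integrable_dirac (by simp)

/-- The law of the position of the symmetric random walk with step `h` after `n` steps. -/
noncomputable def walkLaw (h : ℝ) : ℕ → Measure ℝ
  | 0 => Measure.dirac 0
  | n + 1 => walkLaw h n ∗ (rademacher.map (h * ·))

instance (h : ℝ) (n : ℕ) : IsProbabilityMeasure (walkLaw h n) := by
  induction n with
  | zero => unfold walkLaw; infer_instance
  | succ n ih =>
    have : IsProbabilityMeasure (rademacher.map (h * ·)) :=
      Measure.isProbabilityMeasure_map (by fun_prop)
    unfold walkLaw; infer_instance

open BoundedContinuousFunction in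
theorem integral_walkLaw (h : ℝ) (n : ℕ) (F : ℝ →ᵇ ℝ) :
    ∫ y, F y ∂walkLaw h n = (walkAvg h)^[n] F 0 := by
  induction n generalizing F with
  | zero => simp [walkLaw]
  | succ n ih =>
    have : IsProbabilityMeasure (rademacher.map (h * ·)) :=
      Measure.isProbabilityMeasure_map (by fun_prop)
    have hintg : ∀ x, ∫ y, F (x + y) ∂(rademacher.map (h * ·)) = walkAvg h F x := by
      intro x
      rw [integral_map (by fun_prop) (by fun_prop), integral_rademacher]
      simp [walkAvg, sub_eq_add_neg]
    rw [walkLaw, integral_conv (F.integrable _), Function.iterate_succ_apply]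
    simp_rw [hintg]
    have hb : ∀ x, ‖walkAvg h F x‖ ≤ ‖F‖ := by
      intro x
      have h1 := F.norm_coe_le_norm (x + h)
      have h2 := F.norm_coe_le_norm (x - h)
      rw [Real.norm_eq_abs, abs_le] at *
      unfold walkAvg
      constructor <;> linarith [h1.1, h1.2, h2.1, h2.2]
    exact ih (BoundedContinuousFunction.ofNormedAddCommGroup (walkAvg h F)
      (by unfold walkAvg; fun_prop) _ hb)

theorem charFun_walkLaw (h : ℝ) (n : ℕ) (t : ℝ) :
    charFun (walkLaw h n) t = charFun rademacher (h * t) ^ n := by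
  induction n with
  | zero => simp [walkLaw]
  | succ n ih =>
    have : IsProbabilityMeasure (rademacher.map (h * ·)) :=
      Measure.isProbabilityMeasure_map (by fun_prop)
    rw [walkLaw, charFun_conv, ih, charFun_map_mul, pow_succ]

open BoundedContinuousFunction in
/-- The **de Moivre-Laplace theorem**, tested against bounded continuous functions. -/
theorem tendsto_iterate_walkAvg (F : ℝ →ᵇ ℝ) :
    Tendsto (fun n : ℕ => (walkAvg (√n)⁻¹)^[n] F 0) atTop (𝓝 (∫ y, F y ∂gaussianReal 0 1)) := by
  let P : ℕ → ProbabilityMeasure ℝ := fun n => ⟨walkLaw (√n)⁻¹ n, inferInstance⟩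
  let Q : ProbabilityMeasure ℝ := ⟨gaussianReal 0 1, inferInstance⟩
  have hconv : Tendsto P atTop (𝓝 Q) := by
    refine ProbabilityMeasure.tendsto_iff_tendsto_charFun.2 fun t => ?_
    have := tendsto_charFun_inv_sqrt_mul_pow (P := rademacher) (X := id) (by fun_prop)
      (by simp [integral_rademacher]) (by simp [integral_rademacher]) t
    simpa [P, Q, charFun_walkLaw, charFun_gaussianReal, neg_div] using this
  have := ProbabilityMeasure.tendsto_iff_forall_integral_tendsto.1 hconv F
  simpa [P, Q, integral_walkLaw] using this

end RandomWalk

section OneDimensional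

theorem tendsto_gaussPdf_cocompact : Tendsto gaussPdf (cocompact ℝ) (𝓝 0) := by
  rw [cocompact_eq_atBot_atTop]
  refine Tendsto.sup ?_ tendsto_gaussPdf_atTop
  exact (tendsto_gaussPdf_atTop.comp tendsto_neg_atBot_atTop).congr gaussPdf_neg

open BoundedContinuousFunction in
/-- **Bobkov's functional inequality** for the standard Gaussian measure on the line. -/
theorem gaussIsopProfile_integral_gaussianReal_le {f f' : ℝ → ℝ}
    (hf : ∀ x, HasDerivAt f (f' x) x) (hf01 : ∀ x, f x ∈ Ioo (0 : ℝ) 1)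
    (hf' : UniformContinuous f') {C : ℝ} (hC : ∀ x, |f' x| ≤ C) :
    gaussIsopProfile (∫ x, f x ∂gaussianReal 0 1) ≤
      ∫ x, √(gaussIsopProfile (f x) ^ 2 + f' x ^ 2) ∂gaussianReal 0 1 := by
  have hcf : Continuous f := continuous_iff_continuousAt.2 fun x => (hf x).continuousAt
  have hcI := continuous_gaussIsopProfile
  have hcf' := hf'.continuous
  refine le_of_forall_pos_le_add fun ε hε => ?_
  set K : ℝ → ℝ := fun x => √(gaussIsopProfile (f x) ^ 2 + (|f' x| + ε) ^ 2)
  have hcK : Continuous K := by fun_prop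
  have hC0 : 0 ≤ C := (abs_nonneg _).trans (hC 0)
  have hbK : ∀ x, ‖K x‖ ≤ √(1 ^ 2 + (C + ε) ^ 2) := by
    intro x
    rw [Real.norm_of_nonneg (Real.sqrt_nonneg _)]
    have := gaussIsopProfile_nonneg (f x)
    have := gaussIsopProfile_le_one (f x)
    have := hC x
    change √(gaussIsopProfile (f x) ^ 2 + (|f' x| + ε) ^ 2) ≤ _
    gcongr
  let Fb : ℝ →ᵇ ℝ := BoundedContinuousFunction.ofNormedAddCommGroup f hcf 1 fun x => by
    rw [Real.norm_of_nonneg (hf01 x).1.le]; exact (hf01 x).2.le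
  let Kb : ℝ →ᵇ ℝ := BoundedContinuousFunction.ofNormedAddCommGroup K hcK _ hbK
  have hlim : gaussIsopProfile (∫ x, f x ∂gaussianReal 0 1) ≤ ∫ x, K x ∂gaussianReal 0 1 := by
    refine le_of_tendsto_of_tendsto ((hcI.tendsto _).comp (tendsto_iterate_walkAvg Fb))
      (tendsto_iterate_walkAvg Kb) ?_
    obtain ⟨δ, hδ, hfδ⟩ := Metric.uniformContinuous_iff.1 hf' ε hε
    have h0 : Tendsto (fun n : ℕ => 2 * (√(n : ℝ))⁻¹) atTop (𝓝 0) := by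
      rw [← mul_zero (2 : ℝ)]
      exact (tendsto_inv_atTop_zero.comp
        (Real.tendsto_sqrt_atTop.comp tendsto_natCast_atTop_atTop)).const_mul 2
    filter_upwards [h0.eventually (gt_mem_nhds hδ), eventually_gt_atTop 0] with n hn hn0
    set h : ℝ := (√(n : ℝ))⁻¹ with hh
    have hpos : 0 < h := by positivity
    have hnh : (n : ℝ) * h ^ 2 = 1 := by
      rw [hh, inv_pow, Real.sq_sqrt (Nat.cast_nonneg n)]
      field_simp
    have hmv : ∀ x y, |y - x| = 2 * h → |f y - f x| ≤ 2 * h * (|f' x| + ε) := by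
      intro x y hxy
      have := (convex_ball x δ).norm_image_sub_le_of_norm_hasDerivWithin_le (f := f) (f' := f')
        (C := |f' x| + ε) (x := x) (y := y) (fun z _ => (hf z).hasDerivWithinAt)
        (fun z hz => ?_) (Metric.mem_ball_self hδ)
        (by rw [Metric.mem_ball, Real.dist_eq, hxy]; exact hn)
      · rw [Real.norm_eq_abs, Real.norm_eq_abs, hxy, mul_comm] at this
        exact this
      · have := hfδ hz
        rw [Real.dist_eq] at this
        have h2 := abs_sub_abs_le_abs_sub (f' z) (f' x)
        rw [Real.norm_eq_abs]
        linarith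
    have := gaussIsopProfile_iterate_walkAvg_le h n hf01 (M := fun x => |f' x| + ε)
      (fun x => by positivity)
      (fun x => ⟨hmv x _ (by rw [add_sub_cancel_left, abs_of_pos (by positivity)]),
        hmv x _ (by rw [sub_sub_cancel_left, abs_neg, abs_of_pos (by positivity)])⟩) 0
    simp only [mul_pow, ← mul_assoc, hnh, one_mul] at this
    exact this
  refine hlim.trans ?_
  have hb : ∀ x, K x ≤ √(gaussIsopProfile (f x) ^ 2 + f' x ^ 2) + ε := by
    intro x
    have h1 := Real.sqrt_nonneg (gaussIsopProfile (f x) ^ 2 + f' x ^ 2)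
    have h2 := Real.sq_sqrt (show 0 ≤ gaussIsopProfile (f x) ^ 2 + f' x ^ 2 by positivity)
    have h3 : |f' x| ≤ √(gaussIsopProfile (f x) ^ 2 + f' x ^ 2) :=
      Real.abs_le_sqrt (le_add_of_nonneg_left (sq_nonneg _))
    refine Real.sqrt_le_iff.2 ⟨by positivity, ?_⟩
    nlinarith [sq_abs (f' x)]
  have hintg : Integrable (fun x => √(gaussIsopProfile (f x) ^ 2 + f' x ^ 2))
      (gaussianReal 0 1) := by
    refine Integrable.of_bound (by fun_prop) (√(1 ^ 2 + C ^ 2)) (ae_of_all _ fun x => ?_)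
    rw [Real.norm_of_nonneg (Real.sqrt_nonneg _)]
    have := gaussIsopProfile_nonneg (f x)
    have := gaussIsopProfile_le_one (f x)
    rw [← sq_abs (f' x)]
    have := hC x
    gcongr
  refine (integral_mono (Kb.integrable _) (hintg.add (integrable_const ε)) hb).trans ?_
  simp only [Pi.add_apply]
  rw [integral_add hintg (integrable_const ε)]
  simp

theorem integral_comp_gaussCdf (g : ℝ → ℝ) :
    ∫ x, g (gaussCdf x) ∂gaussianReal 0 1 = ∫ x in Ioo 0 1, g x := by
  rw [← range_gaussCdf, ← image_univ, integral_image_eq_integral_abs_deriv_smul MeasurableSet.univ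
    (fun x _ => (hasDerivAt_gaussCdf x).hasDerivWithinAt) strictMono_gaussCdf.injective.injOn,
    integral_gaussianReal_eq_integral_smul one_ne_zero, setIntegral_univ]
  simp_rw [← gaussPdf_eq_gaussianPDFReal, abs_of_pos (gaussPdf_pos _)]

/-- Bobkov's functional inequality for the uniform distribution on the unit interval. -/
theorem gaussIsopProfile_setIntegral_Ioo_le {f f' : ℝ → ℝ}
    (hf : ∀ x, HasDerivAt f (f' x) x) (hf01 : ∀ x, f x ∈ Ioo (0 : ℝ) 1)
    (hf' : Continuous f') {C : ℝ} (hC : ∀ x, |f' x| ≤ C) :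
    gaussIsopProfile (∫ x in Ioo 0 1, f x) ≤
      ∫ x in Ioo 0 1, √(gaussIsopProfile (f x) ^ 2 + ((√(2 * π))⁻¹ * f' x) ^ 2) := by
  have hcf : Continuous f := continuous_iff_continuousAt.2 fun x => (hf x).continuousAt
  have hcI := continuous_gaussIsopProfile
  have hcΦ := continuous_gaussCdf
  have hcφ := continuous_gaussPdf
  have hbd : ∀ x, |f' (gaussCdf x) * gaussPdf x| ≤ C * gaussPdf x := fun x => by
    rw [abs_mul, abs_of_pos (gaussPdf_pos x)]
    exact mul_le_mul_of_nonneg_right (hC _) (gaussPdf_pos x).le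
  have hC0 : 0 ≤ C := (abs_nonneg _).trans (hC 0)
  have huc : UniformContinuous fun x => f' (gaussCdf x) * gaussPdf x := by
    refine Continuous.uniformContinuous_of_tendsto_cocompact (x := 0) (by fun_prop) ?_
    refine squeeze_zero_norm hbd ?_
    rw [← mul_zero C]
    exact tendsto_gaussPdf_cocompact.const_mul C
  have key := gaussIsopProfile_integral_gaussianReal_le (f := fun x => f (gaussCdf x))
    (fun x => (hf (gaussCdf x)).comp x (hasDerivAt_gaussCdf x)) (fun x => hf01 _) huc (C := C)
    (fun x => (hbd x).trans (mul_le_of_le_one_right hC0 (gaussPdf_le_one x)))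
  rw [integral_comp_gaussCdf f] at key
  refine key.trans ?_
  rw [← integral_comp_gaussCdf
    (fun x => √(gaussIsopProfile (f x) ^ 2 + ((√(2 * π))⁻¹ * f' x) ^ 2))]
  have hb : ∀ {u : ℝ → ℝ}, Continuous u → (∀ x, |u x| ≤ C) → Integrable
      (fun x => √(gaussIsopProfile (f (gaussCdf x)) ^ 2 + u x ^ 2)) (gaussianReal 0 1) := by
    intro u hu huC
    refine Integrable.of_bound (by fun_prop) (√(1 ^ 2 + C ^ 2)) (ae_of_all _ fun x => ?_)
    rw [Real.norm_of_nonneg (Real.sqrt_nonneg _)]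
    have := gaussIsopProfile_nonneg (f (gaussCdf x))
    have := gaussIsopProfile_le_one (f (gaussCdf x))
    rw [← sq_abs (u x)]
    have := huC x
    gcongr
  have hs1 : (√(2 * π))⁻¹ ≤ 1 := by
    refine inv_le_one_of_one_le₀ ?_
    rw [Real.one_le_sqrt]
    linarith [Real.pi_gt_three]
  refine integral_mono (hb huc.continuous
    fun x => (hbd x).trans (mul_le_of_le_one_right hC0 (gaussPdf_le_one x)))
    (hb (by fun_prop) fun x => ?_) fun x => ?_
  · rw [abs_mul, abs_of_nonneg (by positivity)]
    exact (mul_le_of_le_one_left (abs_nonneg _) hs1).trans (hC _)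
  · refine Real.sqrt_le_sqrt (add_le_add le_rfl ?_)
    rw [mul_comm, mul_pow, mul_pow]
    have := gaussPdf_pos x
    have := gaussPdf_le x
    gcongr

end OneDimensional

section Tensorization

theorem sqrt_integral_sq_add_integral_sq_le {α : Type*} [MeasurableSpace α] {μ : Measure α}
    {A B : α → ℝ} (hA : Integrable A μ) (hB : Integrable B μ) :
    √((∫ x, A x ∂μ) ^ 2 + (∫ x, B x ∂μ) ^ 2) ≤ ∫ x, √(A x ^ 2 + B x ^ 2) ∂μ := by
  have h := norm_integral_le_integral_norm (μ := μ) fun x => (A x : ℂ) + B x * Complex.I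
  rw [integral_add hA.ofReal (hB.ofReal.mul_const _), integral_mul_const, integral_complex_ofReal,
    integral_complex_ofReal] at h
  simpa only [Complex.norm_add_mul_I] using h

instance : IsProbabilityMeasure (volume.restrict (Ioo (0 : ℝ) 1)) := ⟨by simp⟩

/-- The uniform distribution on the unit cube. -/
noncomputable def cubeMeasure (n : ℕ) : Measure (Fin n → ℝ) :=
  Measure.pi fun _ => volume.restrict (Ioo (0 : ℝ) 1)

instance (n : ℕ) : IsProbabilityMeasure (cubeMeasure n) := by
  unfold cubeMeasure; infer_instance

theorem integral_cubeMeasure_succ {n : ℕ} {F : (Fin (n + 1) → ℝ) → ℝ}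
    (hF : Integrable F (cubeMeasure (n + 1))) :
    ∫ x, F x ∂cubeMeasure (n + 1) =
      ∫ t in Ioo 0 1, ∫ y, F (Fin.consEquivL ℝ (fun _ => ℝ) (t, y)) ∂cubeMeasure n := by
  have hmp := (measurePreserving_piFinSuccAbove
    (fun _ : Fin (n + 1) => volume.restrict (Ioo (0 : ℝ) 1)) 0).symm
  have he : ∀ p : ℝ × (Fin n → ℝ),
      (MeasurableEquiv.piFinSuccAbove (fun _ : Fin (n + 1) => ℝ) 0).symm p =
        Fin.consEquivL ℝ (fun _ => ℝ) p := fun p => Fin.insertNth_zero' p.1 p.2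
  have h1 := hmp.integral_comp' F
  have h2 := hmp.integrable_comp_of_integrable hF
  simp only [Function.comp_def, he] at h1 h2
  exact h1.symm.trans (integral_prod _ h2)

theorem hasFDerivAt_comp_consEquivL {n : ℕ} {f : (Fin (n + 1) → ℝ) → ℝ} (hf : ContDiff ℝ 1 f)
    (p : ℝ × (Fin n → ℝ)) :
    HasFDerivAt (fun p => f (Fin.consEquivL ℝ (fun _ => ℝ) p))
      ((fderiv ℝ f (Fin.consEquivL ℝ (fun _ => ℝ) p)).comp
        (Fin.consEquivL ℝ (fun _ : Fin (n + 1) => ℝ)).toContinuousLinearMap) p :=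
  ((hf.differentiable one_ne_zero) _).hasFDerivAt.comp p
    (Fin.consEquivL ℝ (fun _ : Fin (n + 1) => ℝ)).hasFDerivAt

theorem norm_sqrt_add_sum_sq_le {n : ℕ} {a C : ℝ} {v : Fin n → ℝ} (ha : |a| ≤ 1)
    (hv : ∀ i, |v i| ≤ C) :
    ‖√(a ^ 2 + ∑ i, v i ^ 2)‖ ≤ √(1 ^ 2 + ∑ _i : Fin n, C ^ 2) := by
  rw [Real.norm_of_nonneg (Real.sqrt_nonneg _)]
  refine Real.sqrt_le_sqrt (add_le_add ?_ (Finset.sum_le_sum fun i _ => ?_))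
  · rw [← sq_abs]; gcongr
  · rw [← sq_abs]; have := hv i; gcongr

theorem abs_gaussIsopProfile_le_one (p : ℝ) : |gaussIsopProfile p| ≤ 1 := by
  rw [abs_of_nonneg (gaussIsopProfile_nonneg p)]
  exact gaussIsopProfile_le_one p

/-- **Bobkov's functional inequality** for the uniform distribution on the unit cube. -/
theorem gaussIsopProfile_integral_cubeMeasure_le {n : ℕ} {f : (Fin n → ℝ) → ℝ}
    (hf : ContDiff ℝ 1 f) (hf01 : ∀ x, f x ∈ Ioo (0 : ℝ) 1) {C : ℝ}
    (hC : ∀ x, ‖fderiv ℝ f x‖ ≤ C) :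
    gaussIsopProfile (∫ x, f x ∂cubeMeasure n) ≤
      ∫ x, √(gaussIsopProfile (f x) ^ 2 +
        ∑ i, ((√(2 * π))⁻¹ * fderiv ℝ f x (Pi.single i 1)) ^ 2) ∂cubeMeasure n := by
  induction n generalizing C with
  | zero =>
    have hx : ∀ x : Fin 0 → ℝ, f x = f 0 := fun x => by rw [Subsingleton.elim x 0]
    simp [hx, Real.sqrt_sq (gaussIsopProfile_nonneg _)]
  | succ n ih =>
    have hcI := continuous_gaussIsopProfile
    have hcf := hf.continuous
    have hcf' := hf.continuous_fderiv one_ne_zero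
    have hf1 : ∀ x, ‖f x‖ ≤ 1 := fun x => by
      rw [Real.norm_of_nonneg (hf01 x).1.le]; exact (hf01 x).2.le
    have hC' : ∀ x i, |(√(2 * π))⁻¹ * fderiv ℝ f x (Pi.single i 1)| ≤ (√(2 * π))⁻¹ * C := by
      intro x i
      rw [abs_mul, abs_of_nonneg (by positivity)]
      gcongr
      refine ((fderiv ℝ f x).le_opNorm _).trans ?_
      rw [Pi.norm_single, norm_one, mul_one]
      exact hC x
    set e := Fin.consEquivL ℝ (fun _ : Fin (n + 1) => ℝ) with he
    have hce : Continuous e := e.continuous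
    set k : ℝ := (√(2 * π))⁻¹ with hk
    have hk0 : 0 < k := by positivity
    set S : (Fin (n + 1) → ℝ) → ℝ := fun x => √(gaussIsopProfile (f x) ^ 2 +
      ∑ i, (k * fderiv ℝ f x (Pi.single i 1)) ^ 2) with hS
    have hcS : Continuous S := by fun_prop
    have hSb : ∀ x, ‖S x‖ ≤ √(1 ^ 2 + ∑ _i : Fin (n + 1), (k * C) ^ 2) := fun x =>
      norm_sqrt_add_sum_sq_le (abs_gaussIsopProfile_le_one _) (hC' x)
    rw [integral_cubeMeasure_succ (F := f)
      (Integrable.of_bound hcf.aestronglyMeasurable 1 (ae_of_all _ hf1)),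
      integral_cubeMeasure_succ (F := S)
      (Integrable.of_bound hcS.aestronglyMeasurable _ (ae_of_all _ hSb))]
    have h10 : e (1, 0) = Pi.single 0 1 := by
      ext i
      refine Fin.cases ?_ (fun j => ?_) i <;> simp [he, Fin.consEquivL, Fin.consLinearEquiv]
    have h01 : ∀ i, e (0, Pi.single i 1) = Pi.single i.succ 1 := by
      intro j
      ext i
      refine Fin.cases ?_ (fun j => ?_) i <;>
        simp [he, Fin.consEquivL, Fin.consLinearEquiv, Pi.single_apply]
    -- the partial functions
    set g : ℝ → ℝ := fun t => ∫ y, f (e (t, y)) ∂cubeMeasure n with hg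
    set D : ℝ → (Fin n → ℝ) → ℝ := fun t y => fderiv ℝ f (e (t, y)) (Pi.single 0 1) with hD
    have hDC : ∀ t y, ‖D t y‖ ≤ C := fun t y => by
      refine ((fderiv ℝ f (e (t, y))).le_opNorm _).trans ?_
      rw [Pi.norm_single, norm_one, mul_one]
      exact hC _
    have hcD : Continuous (Function.uncurry D) := by
      change Continuous fun p : ℝ × (Fin n → ℝ) => fderiv ℝ f (e p) (Pi.single 0 1)
      fun_prop
    have hderiv : ∀ t y, HasDerivAt (fun t => f (e (t, y))) (D t y) t := by
      intro t y
      have h1 : HasDerivAt (fun t : ℝ => (t, y)) ((1 : ℝ), (0 : Fin n → ℝ)) t :=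
        (hasDerivAt_id t).prodMk (hasDerivAt_const t y)
      refine ((hasFDerivAt_comp_consEquivL hf (t, y)).comp_hasDerivAt t h1).congr_deriv ?_
      simp [hD, ← h10, he]
    have hintg : ∀ t, Integrable (fun y => f (e (t, y))) (cubeMeasure n) := fun t =>
      Integrable.of_bound (by fun_prop) 1 (ae_of_all _ fun y => hf1 _)
    have hintD : ∀ t, Integrable (D t) (cubeMeasure n) := fun t =>
      Integrable.of_bound (by fun_prop) C (ae_of_all _ fun y => hDC t y)
    have hgd : ∀ t, HasDerivAt g (∫ y, D t y ∂cubeMeasure n) t := fun t =>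
      (hasDerivAt_integral_of_dominated_loc_of_deriv_le (s := univ) (bound := fun _ => C) univ_mem
        (Eventually.of_forall fun t => (hintg t).aestronglyMeasurable) (hintg t)
        (hintD t).aestronglyMeasurable (ae_of_all _ fun y t _ => hDC t y) (integrable_const C)
        (ae_of_all _ fun y t _ => hderiv t y)).2
    have hg01 : ∀ t, g t ∈ Ioo (0 : ℝ) 1 := by
      intro t
      constructor
      · refine (integral_pos_iff_support_of_nonneg (fun y => (hf01 _).1.le) (hintg t)).2 ?_
        have : Function.support (fun y => f (e (t, y))) = univ :=
          eq_univ_of_forall fun y => (hf01 _).1.ne'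
        rw [this]; simp
      · have h1 : 0 < ∫ y, (1 - f (e (t, y))) ∂cubeMeasure n := by
          refine (integral_pos_iff_support_of_nonneg (fun y => sub_nonneg.2 (hf01 _).2.le)
            ((integrable_const 1).sub (hintg t))).2 ?_
          have : Function.support (fun y => 1 - f (e (t, y))) = univ :=
            eq_univ_of_forall fun y => (sub_pos.2 (hf01 _).2).ne'
          rw [this]; simp
        rw [integral_sub (integrable_const 1) (hintg t)] at h1
        simpa using h1
    have hcg' : Continuous fun t => ∫ y, D t y ∂cubeMeasure n :=
      continuous_of_dominated (bound := fun _ => C) (fun t => (hintD t).aestronglyMeasurable)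
        (fun t => ae_of_all _ fun y => hDC t y) (integrable_const C)
        (ae_of_all _ fun y => by fun_prop)
    have hg'C : ∀ t, |∫ y, D t y ∂cubeMeasure n| ≤ C := fun t => by
      have := norm_integral_le_of_norm_le_const (μ := cubeMeasure n) (ae_of_all _ (hDC t))
      simpa using this
    refine (gaussIsopProfile_setIntegral_Ioo_le hgd hg01 hcg' hg'C).trans ?_
    have hcg : Continuous g := continuous_iff_continuousAt.2 fun t => (hgd t).continuousAt
    have hcSint : Continuous fun t => ∫ y, S (e (t, y)) ∂cubeMeasure n :=
      continuous_of_dominated (bound := fun _ => √(1 ^ 2 + ∑ _i : Fin (n + 1), (k * C) ^ 2))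
        (fun t => by fun_prop) (fun t => ae_of_all _ fun y => hSb _) (integrable_const _)
        (ae_of_all _ fun y => by fun_prop)
    refine integral_mono ?_ ?_ fun t => ?_
    · refine Integrable.of_bound (by fun_prop) (√(1 ^ 2 + ∑ _i : Fin 1, (k * C) ^ 2))
        (ae_of_all _ fun t => ?_)
      have := norm_sqrt_add_sum_sq_le (n := 1) (v := fun _ => k * ∫ y, D t y ∂cubeMeasure n)
        (C := k * C) (abs_gaussIsopProfile_le_one (g t)) (fun _ => by
          rw [abs_mul, abs_of_pos hk0]
          exact mul_le_mul_of_nonneg_left (hg'C t) hk0.le)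
      simpa only [Fin.sum_univ_one] using this
    · exact Integrable.of_bound hcSint.aestronglyMeasurable
        (√(1 ^ 2 + ∑ _i : Fin (n + 1), (k * C) ^ 2))
        (ae_of_all _ fun t => by
          have := norm_integral_le_of_norm_le_const (μ := cubeMeasure n)
            (ae_of_all _ fun y => hSb (e (t, y)))
          simpa using this)
    · -- the inequality in the remaining variables
      have hft : ∀ y, HasFDerivAt (fun y => f (e (t, y)))
          (((fderiv ℝ f (e (t, y))).comp e.toContinuousLinearMap).comp
            (ContinuousLinearMap.inr ℝ ℝ (Fin n → ℝ))) y := fun y =>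
        (hasFDerivAt_comp_consEquivL hf (t, y)).comp y (hasFDerivAt_prodMk_right t y)
      have hih := ih (f := fun y => f (e (t, y)))
        (hf.comp (e.contDiff.comp (contDiff_prodMk_right t)))
        (fun y => hf01 _)
        (C := C * ‖e.toContinuousLinearMap‖ * ‖ContinuousLinearMap.inr ℝ ℝ (Fin n → ℝ)‖) fun y => by
          rw [(hft y).fderiv]
          refine (ContinuousLinearMap.opNorm_comp_le _ _).trans ?_
          gcongr
          refine (ContinuousLinearMap.opNorm_comp_le _ _).trans ?_
          gcongr
          exact hC _
      have hih' : gaussIsopProfile (g t) ≤ ∫ y, √(gaussIsopProfile (f (e (t, y))) ^ 2 +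
          ∑ i : Fin n, (k * fderiv ℝ f (e (t, y)) (Pi.single i.succ 1)) ^ 2) ∂cubeMeasure n := by
        refine hih.trans_eq ?_
        congr 1 with y
        rw [(hft y).fderiv]
        simp [h01]
      have hintA : Integrable (fun y => √(gaussIsopProfile (f (e (t, y))) ^ 2 +
          ∑ i : Fin n, (k * fderiv ℝ f (e (t, y)) (Pi.single i.succ 1)) ^ 2)) (cubeMeasure n) :=
        Integrable.of_bound (by fun_prop) _ (ae_of_all _ fun y =>
          norm_sqrt_add_sum_sq_le (abs_gaussIsopProfile_le_one _) fun i => hC' _ _)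
      have hmink := sqrt_integral_sq_add_integral_sq_le hintA ((hintD t).const_mul k)
      rw [integral_const_mul] at hmink
      have hI0 := gaussIsopProfile_nonneg (g t)
      refine (Real.sqrt_le_sqrt (add_le_add (pow_le_pow_left₀ hI0 hih' 2) le_rfl)).trans
        (hmink.trans_eq ?_)
      congr 1 with y
      rw [Real.sq_sqrt (by positivity), hS]
      dsimp only
      rw [Fin.sum_univ_succ]
      congr 1
      ring

end Tensorization

section EuclideanCube

variable {d : ℕ}

theorem measurableSet_unitCube : MeasurableSet (unitCube d) := by
  have : unitCube d = ⋂ i, (fun x : EuclideanSpace ℝ (Fin d) => x i) ⁻¹' Ioo 0 1 := by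
    ext x; simp [unitCube]
  rw [this]
  exact MeasurableSet.iInter fun i => (by fun_prop : Measurable _) measurableSet_Ioo

theorem integral_cubeMeasure_toLp (F : EuclideanSpace ℝ (Fin d) → ℝ) :
    ∫ x, F (WithLp.toLp 2 x) ∂cubeMeasure d = ∫ x in unitCube d, F x := by
  have h := (PiLp.volume_preserving_toLp (Fin d)).setIntegral_preimage_emb
    (MeasurableEquiv.toLp 2 (Fin d → ℝ)).measurableEmbedding F (unitCube d)
  have hpre : WithLp.toLp 2 ⁻¹' unitCube d = univ.pi fun _ : Fin d => Ioo (0 : ℝ) 1 := by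
    ext x; simp [unitCube]
  rw [← h, hpre, volume_pi, Measure.restrict_pi_pi, cubeMeasure]

instance : IsProbabilityMeasure (volume.restrict (unitCube d)) := by
  have h := (PiLp.volume_preserving_toLp (Fin d)).measure_preimage
    (measurableSet_unitCube (d := d)).nullMeasurableSet
  have hpre : WithLp.toLp 2 ⁻¹' unitCube d = univ.pi fun _ : Fin d => Ioo (0 : ℝ) 1 := by
    ext x; simp [unitCube]
  refine ⟨?_⟩
  rw [Measure.restrict_apply_univ, ← h, hpre, volume_pi, Measure.pi_pi]
  simp

theorem norm_sq_eq_sum_apply_single (L : EuclideanSpace ℝ (Fin d) →L[ℝ] ℝ) :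
    ‖L‖ ^ 2 = ∑ i, L (EuclideanSpace.single i 1) ^ 2 := by
  rw [← (InnerProductSpace.toDual ℝ _).symm.norm_map L, EuclideanSpace.real_norm_sq_eq]
  refine Finset.sum_congr rfl fun i _ => ?_
  rw [← InnerProductSpace.toDual_symm_apply (y := L), EuclideanSpace.inner_single_right]
  simp

theorem gaussIsopProfile_setIntegral_unitCube_le_of_mem_Ioo {w : EuclideanSpace ℝ (Fin d) → ℝ}
    (hw : ContDiff ℝ 1 w) (hw01 : ∀ x, w x ∈ Ioo (0 : ℝ) 1) {C : ℝ}
    (hC : ∀ x, ‖fderiv ℝ w x‖ ≤ C) :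
    gaussIsopProfile (∫ x in unitCube d, w x) ≤
      (∫ x in unitCube d, gaussIsopProfile (w x)) +
        (√(2 * π))⁻¹ * ∫ x in unitCube d, ‖fderiv ℝ w x‖ := by
  have hcI := continuous_gaussIsopProfile
  have hcw := hw.continuous
  have hcw' := hw.continuous_fderiv one_ne_zero
  have hk : 0 < (√(2 * π))⁻¹ := by positivity
  let T : (Fin d → ℝ) ≃L[ℝ] EuclideanSpace ℝ (Fin d) :=
    (EuclideanSpace.equiv (Fin d) ℝ).symm
  have hd : ∀ x, fderiv ℝ (fun x => w (T x)) x = (fderiv ℝ w (T x)).comp T.toContinuousLinearMap :=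
    fun x => (((hw.differentiable one_ne_zero) (T x)).hasFDerivAt.comp x T.hasFDerivAt).fderiv
  have key := gaussIsopProfile_integral_cubeMeasure_le (f := fun x => w (T x))
    (hw.comp T.contDiff) (fun x => hw01 _) (C := C * ‖T.toContinuousLinearMap‖) fun x => by
      rw [hd]
      refine (ContinuousLinearMap.opNorm_comp_le _ _).trans ?_
      gcongr
      exact hC _
  have hT : ∀ i, T (Pi.single i 1) = EuclideanSpace.single i 1 := fun i => rfl
  simp only [hd, ContinuousLinearMap.comp_apply, ContinuousLinearEquiv.coe_coe, hT, mul_pow,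
    ← Finset.mul_sum, ← norm_sq_eq_sum_apply_single] at key
  have h0 : ∫ x, w (T x) ∂cubeMeasure d = ∫ x in unitCube d, w x := integral_cubeMeasure_toLp w
  rw [h0] at key
  replace key := key.trans_eq (integral_cubeMeasure_toLp fun x =>
    √(gaussIsopProfile (w x) ^ 2 + (√(2 * π))⁻¹ ^ 2 * ‖fderiv ℝ w x‖ ^ 2))
  refine key.trans ?_
  have hi1 : Integrable (fun x => gaussIsopProfile (w x)) (volume.restrict (unitCube d)) :=
    Integrable.of_bound (by fun_prop) 1 (ae_of_all _ fun x => abs_gaussIsopProfile_le_one _)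
  have hi2 : Integrable (fun x => ‖fderiv ℝ w x‖) (volume.restrict (unitCube d)) :=
    Integrable.of_bound (by fun_prop) C (ae_of_all _ fun x => by rw [norm_norm]; exact hC x)
  rw [← integral_const_mul, ← integral_add hi1 (hi2.const_mul _)]
  refine integral_mono_of_nonneg (ae_of_all _ fun x => Real.sqrt_nonneg _)
    (hi1.add (hi2.const_mul _)) (ae_of_all _ fun x => ?_)
  have h0 := gaussIsopProfile_nonneg (w x)
  refine Real.sqrt_le_iff.2 ⟨by positivity, ?_⟩
  have : 0 ≤ gaussIsopProfile (w x) * ((√(2 * π))⁻¹ * ‖fderiv ℝ w x‖) := by positivity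
  nlinarith

/-- The `L¹` form of Bobkov's inequality on the unit cube. -/
theorem gaussIsopProfile_setIntegral_unitCube_le {u : EuclideanSpace ℝ (Fin d) → ℝ}
    (hu : ContDiff ℝ 1 u) (hu01 : ∀ x, u x ∈ Icc (0 : ℝ) 1) {C : ℝ}
    (hC : ∀ x, ‖fderiv ℝ u x‖ ≤ C) :
    gaussIsopProfile (∫ x in unitCube d, u x) ≤
      (∫ x in unitCube d, gaussIsopProfile (u x)) +
        (√(2 * π))⁻¹ * ∫ x in unitCube d, ‖fderiv ℝ u x‖ := by
  have hcI := continuous_gaussIsopProfile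
  have hcu := hu.continuous
  have hC0 : 0 ≤ C := (norm_nonneg _).trans (hC 0)
  have hi : Integrable (fun x => ‖fderiv ℝ u x‖) (volume.restrict (unitCube d)) :=
    Integrable.of_bound (hu.continuous_fderiv one_ne_zero).norm.aestronglyMeasurable C
      (ae_of_all _ fun x => by rw [norm_norm]; exact hC x)
  have hcontu : Continuous fun δ : ℝ => ∫ x in unitCube d, (δ + (1 - 2 * δ) * u x) := by
    have hiu : Integrable u (volume.restrict (unitCube d)) :=
      Integrable.of_bound (by fun_prop) 1 (ae_of_all _ fun x => by
        rw [Real.norm_of_nonneg (hu01 x).1]; exact (hu01 x).2)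
    have : ∀ δ : ℝ, ∫ x in unitCube d, (δ + (1 - 2 * δ) * u x) =
        δ + (1 - 2 * δ) * ∫ x in unitCube d, u x := by
      intro δ
      rw [integral_add (integrable_const _) (hiu.const_mul _), integral_const_mul]
      simp
    simp only [this]
    fun_prop
  have hcontI : Continuous fun δ : ℝ =>
      ∫ x in unitCube d, gaussIsopProfile (δ + (1 - 2 * δ) * u x) :=
    continuous_of_dominated (bound := fun _ => 1) (fun δ => by fun_prop)
      (fun δ => ae_of_all _ fun x => abs_gaussIsopProfile_le_one _) (integrable_const _)
      (ae_of_all _ fun x => by fun_prop)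
  have h1 : Tendsto (fun δ : ℝ => gaussIsopProfile (∫ x in unitCube d, (δ + (1 - 2 * δ) * u x)))
      (𝓝[>] 0) (𝓝 (gaussIsopProfile (∫ x in unitCube d, u x))) := by
    simpa [Function.comp_def] using ((hcI.comp hcontu).tendsto 0).mono_left nhdsWithin_le_nhds
  have h2 : Tendsto (fun δ : ℝ => (∫ x in unitCube d, gaussIsopProfile (δ + (1 - 2 * δ) * u x)) +
      (√(2 * π))⁻¹ * ∫ x in unitCube d, ‖fderiv ℝ u x‖) (𝓝[>] 0)
      (𝓝 ((∫ x in unitCube d, gaussIsopProfile (u x)) +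
        (√(2 * π))⁻¹ * ∫ x in unitCube d, ‖fderiv ℝ u x‖)) := by
    simpa using ((hcontI.tendsto 0).mono_left nhdsWithin_le_nhds).add_const
      ((√(2 * π))⁻¹ * ∫ x in unitCube d, ‖fderiv ℝ u x‖)
  refine le_of_tendsto_of_tendsto h1 h2 ?_
  filter_upwards [self_mem_nhdsWithin, nhdsWithin_le_nhds (gt_mem_nhds (show (0 : ℝ) < 1 / 2 by
    norm_num))] with δ hδ hδ'
  rw [mem_Ioi] at hδ
  have hfd : ∀ x, fderiv ℝ (fun x => δ + (1 - 2 * δ) * u x) x = (1 - 2 * δ) • fderiv ℝ u x :=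
    fun x => ((((hu.differentiable one_ne_zero) x).hasFDerivAt.const_mul _).const_add _).fderiv
  have hfn : ∀ x, ‖fderiv ℝ (fun x => δ + (1 - 2 * δ) * u x) x‖ ≤ ‖fderiv ℝ u x‖ := fun x => by
    rw [hfd, norm_smul, Real.norm_of_nonneg (by linarith)]
    exact mul_le_of_le_one_left (norm_nonneg _) (by linarith)
  refine (gaussIsopProfile_setIntegral_unitCube_le_of_mem_Ioo
    (w := fun x => δ + (1 - 2 * δ) * u x) (by fun_prop) (fun x => ⟨?_, ?_⟩)
    fun x => (hfn x).trans (hC x)).trans ?_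
  · have := mul_nonneg (show 0 ≤ 1 - 2 * δ by linarith) (hu01 x).1
    linarith
  · have := mul_le_mul_of_nonneg_left (hu01 x).2 (show 0 ≤ 1 - 2 * δ by linarith)
    linarith
  · refine add_le_add le_rfl (mul_le_mul_of_nonneg_left ?_ (by positivity))
    exact integral_mono_of_nonneg (ae_of_all _ fun x => norm_nonneg _) hi (ae_of_all _ hfn)

end EuclideanCube

section Mollification

open scoped Convolution

variable {d : ℕ}

theorem fderiv_convolution_bump_apply {F : Type*} [NormedAddCommGroup F] [NormedSpace ℝ F]
    [CompleteSpace F] (φ : ContDiffBump (0 : EuclideanSpace ℝ (Fin d)))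
    {Y : EuclideanSpace ℝ (Fin d) → F} (hY : LocallyIntegrable Y)
    (x v : EuclideanSpace ℝ (Fin d)) :
    fderiv ℝ (Y ⋆[(ContinuousLinearMap.lsmul ℝ ℝ).flip, volume] φ.normed volume) x v =
      ∫ y, fderiv ℝ (φ.normed volume) (x - y) v • Y y := by
  have h := (φ.hasCompactSupport_normed (μ := volume)).hasFDerivAt_convolution_right
    (ContinuousLinearMap.lsmul ℝ ℝ).flip hY (φ.contDiff_normed (n := 1)) x
  rw [h.fderiv, convolution_precompR_apply _ hY
    (φ.hasCompactSupport_normed.fderiv ℝ)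
    ((φ.contDiff_normed (n := 1)).continuous_fderiv one_ne_zero)]
  rfl

/-- The mollification of the indicator of a set by a bump function. -/
noncomputable def mollify (φ : ContDiffBump (0 : EuclideanSpace ℝ (Fin d)))
    (E : Set (EuclideanSpace ℝ (Fin d))) : EuclideanSpace ℝ (Fin d) → ℝ :=
  E.indicator (fun _ => (1 : ℝ)) ⋆[(ContinuousLinearMap.lsmul ℝ ℝ).flip, volume] φ.normed volume

variable {E : Set (EuclideanSpace ℝ (Fin d))}
  (φ : ContDiffBump (0 : EuclideanSpace ℝ (Fin d)))

theorem contDiff_mollify (hE : MeasurableSet E) : ContDiff ℝ 1 (mollify φ E) :=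
  φ.hasCompactSupport_normed.contDiff_convolution_right (n := 1) _
    ((locallyIntegrable_const 1).indicator hE) φ.contDiff_normed

theorem fderiv_mollify_apply (hE : MeasurableSet E) (x v : EuclideanSpace ℝ (Fin d)) :
    fderiv ℝ (mollify φ E) x v = ∫ y in E, fderiv ℝ (φ.normed volume) (x - y) v := by
  rw [mollify, fderiv_convolution_bump_apply φ ((locallyIntegrable_const 1).indicator hE),
    ← integral_indicator hE]
  congr 1 with y
  by_cases hy : y ∈ E <;> simp [hy]

theorem mollify_mem_Icc (hE : MeasurableSet E) (x : EuclideanSpace ℝ (Fin d)) :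
    mollify φ E x ∈ Icc (0 : ℝ) 1 := by
  have h : mollify φ E x = ∫ y in E, φ.normed volume (x - y) := by
    rw [mollify, convolution_def, ← integral_indicator hE]
    congr 1 with y
    by_cases hy : y ∈ E <;> simp [hy]
  rw [h]
  refine ⟨integral_nonneg fun y => φ.nonneg_normed _, ?_⟩
  refine (setIntegral_le_integral (φ.integrable_normed.comp_sub_left x)
    (ae_of_all _ fun y => φ.nonneg_normed _)).trans_eq ?_
  rw [integral_sub_left_eq_self (φ.normed volume) volume x, φ.integral_normed]

theorem exists_norm_fderiv_bump_le : ∃ C, ∀ x, ‖fderiv ℝ (φ.normed volume) x‖ ≤ C :=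
  (φ.hasCompactSupport_normed.fderiv ℝ).exists_bound_of_continuous
    ((φ.contDiff_normed (n := 1)).continuous_fderiv one_ne_zero)

theorem exists_norm_fderiv_mollify_le (hE : MeasurableSet E) (hE' : volume E ≠ ⊤) :
    ∃ C, ∀ x, ‖fderiv ℝ (mollify φ E) x‖ ≤ C := by
  obtain ⟨C, hC⟩ := exists_norm_fderiv_bump_le φ
  have hC0 : 0 ≤ C := (norm_nonneg _).trans (hC 0)
  refine ⟨C * volume.real E, fun x => ContinuousLinearMap.opNorm_le_bound _ (by positivity)
    fun v => ?_⟩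
  rw [fderiv_mollify_apply φ hE]
  refine (norm_setIntegral_le_of_norm_le_const (C := C * ‖v‖) hE'.lt_top fun y _ => ?_).trans_eq
    (by ring)
  exact ((fderiv ℝ (φ.normed volume) (x - y)).le_opNorm v).trans (by gcongr; exact hC _)

theorem fderiv_bump_neg (x v : EuclideanSpace ℝ (Fin d)) :
    fderiv ℝ (φ.normed volume) (-x) v = -fderiv ℝ (φ.normed volume) x v := by
  have h := (((φ.contDiff_normed (n := 1) (μ := volume)).differentiable one_ne_zero
    (-x)).hasFDerivAt.comp x (hasFDerivAt_id (𝕜 := ℝ) x).neg).fderiv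
  have h' : (φ.normed volume ∘ fun x => -id x) = φ.normed volume := funext φ.normed_neg
  change fderiv ℝ (φ.normed volume ∘ fun x => -id x) x = _ at h
  rw [h'] at h
  rw [h]
  simp

/-- Integration by parts against a mollified vector field. -/
theorem setIntegral_divergence_convolution_bump (hE : MeasurableSet E) (hE' : volume E ≠ ⊤)
    {Y : EuclideanSpace ℝ (Fin d) → EuclideanSpace ℝ (Fin d)} (hY : Integrable Y) :
    ∫ x in E, ∑ i, fderiv ℝ (Y ⋆[(ContinuousLinearMap.lsmul ℝ ℝ).flip, volume] φ.normed volume) x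
        (EuclideanSpace.single i 1) i =
      -∫ y, ∑ i, Y y i * fderiv ℝ (mollify φ E) y (EuclideanSpace.single i 1) := by
  obtain ⟨C, hC⟩ := exists_norm_fderiv_bump_le φ
  have hcρ : Continuous (fderiv ℝ (φ.normed volume)) :=
    (φ.contDiff_normed (n := 1)).continuous_fderiv one_ne_zero
  have hYi : ∀ i, Integrable fun y => Y y i := fun i =>
    (EuclideanSpace.proj (𝕜 := ℝ) i).integrable_comp hY
  have hbd : ∀ x i, ‖fderiv ℝ (φ.normed volume) x (EuclideanSpace.single i 1)‖ ≤ C := by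
    intro x i
    refine ((fderiv ℝ (φ.normed volume) x).le_opNorm _).trans ?_
    simpa using hC x
  have hcomp : ∀ x i, fderiv ℝ (Y ⋆[(ContinuousLinearMap.lsmul ℝ ℝ).flip, volume]
      φ.normed volume) x (EuclideanSpace.single i 1) i =
      ∫ y, Y y i * fderiv ℝ (φ.normed volume) (x - y) (EuclideanSpace.single i 1) := by
    intro x i
    rw [fderiv_convolution_bump_apply φ hY.locallyIntegrable]
    have := (EuclideanSpace.proj (𝕜 := ℝ) i).integral_comp_comm
      (φ := fun y => fderiv ℝ (φ.normed volume) (x - y) (EuclideanSpace.single i 1) • Y y)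
      (hY.bdd_smul C (by fun_prop) (ae_of_all _ fun y => hbd _ _))
    refine this.symm.trans ?_
    congr 1 with y
    simp [mul_comm]
  have hprod : ∀ i, Integrable (fun p : EuclideanSpace ℝ (Fin d) × EuclideanSpace ℝ (Fin d) =>
      Y p.2 i * fderiv ℝ (φ.normed volume) (p.1 - p.2) (EuclideanSpace.single i 1))
      ((volume.restrict E).prod volume) := by
    intro i
    have hfin : IsFiniteMeasure (volume.restrict E) := ⟨by simpa using hE'.lt_top⟩
    exact ((hYi i).comp_snd (volume.restrict E)).mul_bdd (c := C) (by fun_prop)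
      (ae_of_all _ fun p => hbd _ _)
  simp only [hcomp]
  rw [integral_finsetSum _ fun i _ => (hprod i).integral_prod_left]
  have hintg : ∀ i, Integrable fun y =>
      Y y i * fderiv ℝ (mollify φ E) y (EuclideanSpace.single i 1) := by
    intro i
    obtain ⟨C', hC'⟩ := exists_norm_fderiv_mollify_le φ hE hE'
    have hcm := (contDiff_mollify φ hE).continuous_fderiv one_ne_zero
    refine (hYi i).mul_bdd (c := C') (by fun_prop) (ae_of_all _ fun y => ?_)
    refine ((fderiv ℝ (mollify φ E) y).le_opNorm _).trans ?_
    simpa using hC' y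
  rw [integral_finsetSum _ fun i _ => hintg i, ← Finset.sum_neg_distrib]
  refine Finset.sum_congr rfl fun i _ => ?_
  rw [integral_integral_swap (hprod i), ← integral_neg]
  congr 1 with y
  dsimp only
  rw [fderiv_mollify_apply φ hE, integral_const_mul, ← mul_neg, ← integral_neg]
  congr 2 with x
  rw [← fderiv_bump_neg, neg_sub]

theorem norm_convolution_bump_le {Y : EuclideanSpace ℝ (Fin d) → EuclideanSpace ℝ (Fin d)}
    (hY : ∀ x, ‖Y x‖ ≤ 1) (x : EuclideanSpace ℝ (Fin d)) :
    ‖(Y ⋆[(ContinuousLinearMap.lsmul ℝ ℝ).flip, volume] φ.normed volume) x‖ ≤ 1 := by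
  rw [convolution_def]
  refine (norm_integral_le_of_norm_le (φ.integrable_normed.comp_sub_left x)
    (ae_of_all _ fun y => ?_)).trans_eq ?_
  · rw [ContinuousLinearMap.flip_apply, ContinuousLinearMap.lsmul_apply, norm_smul,
      Real.norm_of_nonneg (φ.nonneg_normed _)]
    exact mul_le_of_le_one_right (φ.nonneg_normed _) (hY y)
  · rw [integral_sub_left_eq_self (φ.normed volume) volume x, φ.integral_normed]

/-- The total variation of a mollified indicator is controlled by the relative perimeter. -/
theorem setIntegral_norm_fderiv_mollify_le_relPerimeter
    {Ω K L : Set (EuclideanSpace ℝ (Fin d))} (hE : MeasurableSet E) (hE' : volume E ≠ ⊤)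
    (hK : MeasurableSet K) (hL : IsCompact L) (hLΩ : L ⊆ Ω)
    (hKL : ∀ x ∈ K, Metric.ball x φ.rOut ⊆ L) :
    ENNReal.ofReal (∫ x in K, ‖fderiv ℝ (mollify φ E) x‖) ≤ relPerimeter d E Ω := by
  have hcm := (contDiff_mollify φ hE).continuous_fderiv one_ne_zero
  let G : EuclideanSpace ℝ (Fin d) → EuclideanSpace ℝ (Fin d) := fun x =>
    (InnerProductSpace.toDual ℝ _).symm (fderiv ℝ (mollify φ E) x)
  have hcG : Continuous G := (InnerProductSpace.toDual ℝ _).symm.continuous.comp hcm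
  have hGn : ∀ x, ‖G x‖ = ‖fderiv ℝ (mollify φ E) x‖ := fun x => LinearIsometryEquiv.norm_map _ _
  have hGi : ∀ x i, fderiv ℝ (mollify φ E) x (EuclideanSpace.single i 1) = G x i := fun x i => by
    rw [← InnerProductSpace.toDual_symm_apply (y := fderiv ℝ (mollify φ E) x),
      EuclideanSpace.inner_single_right]
    simp [G]
  let Y : EuclideanSpace ℝ (Fin d) → EuclideanSpace ℝ (Fin d) :=
    K.indicator fun x => -(‖G x‖⁻¹ • G x)
  have hY1 : ∀ x, ‖Y x‖ ≤ 1 := by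
    intro x
    by_cases hx : x ∈ K
    · simp only [Y, indicator_of_mem hx, norm_neg, norm_smul, norm_inv, norm_norm]
      exact inv_mul_le_one
    · simp [Y, hx]
  have hKfin : volume K ≠ ⊤ := by
    refine (measure_mono fun x hx => ?_).trans_lt hL.measure_lt_top |>.ne
    exact hKL x hx (Metric.mem_ball_self φ.rOut_pos)
  have hY : Integrable Y := by
    rw [integrable_indicator_iff hK]
    have hfin : IsFiniteMeasure (volume.restrict K) := ⟨by simpa using hKfin.lt_top⟩
    refine Integrable.of_bound (Measurable.aestronglyMeasurable (by fun_prop)) 1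
      (ae_of_all _ fun x => ?_)
    rw [norm_neg, norm_smul, norm_inv, norm_norm]
    exact inv_mul_le_one
  set X := Y ⋆[(ContinuousLinearMap.lsmul ℝ ℝ).flip, volume] φ.normed volume with hX
  have hsupp : Function.support X ⊆ L := by
    refine (support_convolution_subset_swap _).trans ?_
    rintro z ⟨a, ha, b, hb, rfl⟩
    rw [φ.support_normed_eq, mem_ball_zero_iff] at ha
    have hbK : b ∈ K := by
      by_contra hb'
      exact hb (indicator_of_notMem hb' _)
    refine hKL b hbK ?_
    simpa [Metric.mem_ball, dist_eq_norm] using ha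
  have htsupp : tsupport X ⊆ L := closure_minimal hsupp hL.isClosed
  have hdiv : ∫ x in E, ∑ i, fderiv ℝ X x (EuclideanSpace.single i 1) i =
      ∫ x in K, ‖fderiv ℝ (mollify φ E) x‖ := by
    rw [hX, setIntegral_divergence_convolution_bump φ hE hE' hY, ← integral_neg,
      ← integral_indicator hK]
    congr 1 with x
    by_cases hx : x ∈ K
    · simp only [Y, indicator_of_mem hx, hGi, ← hGn, PiLp.neg_apply, PiLp.smul_apply, smul_eq_mul,
        neg_mul, Finset.sum_neg_distrib, neg_neg, mul_assoc, ← Finset.mul_sum, ← pow_two,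
        ← EuclideanSpace.real_norm_sq_eq]
      by_cases h0 : ‖G x‖ = 0
      · simp [h0]
      · field_simp
    · simp [Y, hx]
  rw [← hdiv]
  unfold relPerimeter
  refine le_iSup_of_le X (le_iSup_of_le ?_ (le_iSup_of_le ?_ (le_iSup_of_le ?_
    (le_iSup_of_le ?_ le_rfl))))
  · exact φ.hasCompactSupport_normed.contDiff_convolution_right (n := 1) _ hY.locallyIntegrable
      φ.contDiff_normed
  · exact hL.of_isClosed_subset (isClosed_tsupport _) htsupp
  · exact htsupp.trans hLΩ
  · exact norm_convolution_bump_le φ hY1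

end Mollification

section Dilation

open scoped Convolution

variable {d : ℕ} {E : Set (EuclideanSpace ℝ (Fin d))} {s : ℝ}

/-- The dilation of ratio `s` fixing the center of the unit cube. -/
noncomputable def cubeDilation (s : ℝ) (x : EuclideanSpace ℝ (Fin d)) :
    EuclideanSpace ℝ (Fin d) :=
  s • x + (1 - s) • WithLp.toLp 2 fun _ => (1 / 2 : ℝ)

theorem cubeDilation_apply (s : ℝ) (x : EuclideanSpace ℝ (Fin d)) (i : Fin d) :
    cubeDilation s x i = s * x i + (1 - s) / 2 := by
  simp [cubeDilation, div_eq_mul_inv]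

theorem measurable_cubeDilation (s : ℝ) : Measurable (cubeDilation (d := d) s) := by
  unfold cubeDilation; fun_prop

/-- The open cube of side `s` with the same center as the unit cube. -/
def centeredCube (d : ℕ) (s : ℝ) : Set (EuclideanSpace ℝ (Fin d)) :=
  {x | ∀ i, x i ∈ Ioo ((1 - s) / 2) ((1 + s) / 2)}

theorem measurableSet_centeredCube : MeasurableSet (centeredCube d s) := by
  have : centeredCube d s =
      ⋂ i, (fun x : EuclideanSpace ℝ (Fin d) => x i) ⁻¹' Ioo ((1 - s) / 2) ((1 + s) / 2) := by
    ext x; simp [centeredCube]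
  rw [this]
  exact MeasurableSet.iInter fun i => (by fun_prop : Measurable _) measurableSet_Ioo

theorem cubeDilation_mem_centeredCube_iff (hs : 0 < s) (x : EuclideanSpace ℝ (Fin d)) :
    cubeDilation s x ∈ centeredCube d s ↔ x ∈ unitCube d := by
  refine forall_congr' fun i => ?_
  rw [cubeDilation_apply, mem_Ioo, mem_Ioo]
  constructor
  · rintro ⟨h1, h2⟩
    constructor <;> nlinarith
  · rintro ⟨h1, h2⟩
    constructor <;> nlinarith

theorem integral_comp_cubeDilation (hs : 0 < s) (g : EuclideanSpace ℝ (Fin d) → ℝ) :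
    ∫ x in unitCube d, g (cubeDilation s x) = (s ^ d)⁻¹ * ∫ x in centeredCube d s, g x := by
  have h : ∀ x, (unitCube d).indicator (fun x => g (cubeDilation s x)) x =
      (centeredCube d s).indicator g (cubeDilation s x) := fun x => by
    by_cases hx : x ∈ unitCube d
    · rw [indicator_of_mem hx, indicator_of_mem ((cubeDilation_mem_centeredCube_iff hs x).2 hx)]
    · rw [indicator_of_notMem hx,
        indicator_of_notMem (mt (cubeDilation_mem_centeredCube_iff hs x).1 hx)]
  rw [← integral_indicator measurableSet_unitCube, ← integral_indicator measurableSet_centeredCube]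
  simp_rw [h, cubeDilation]
  rw [Measure.integral_comp_smul volume (fun y => (centeredCube d s).indicator g
    (y + (1 - s) • WithLp.toLp 2 fun _ => (1 / 2 : ℝ))) s, integral_add_right_eq_self,
    finrank_euclideanSpace_fin, abs_of_pos (by positivity), smul_eq_mul]

theorem quasiMeasurePreserving_cubeDilation (hs : 0 < s) :
    Measure.QuasiMeasurePreserving (cubeDilation (d := d) s) volume volume := by
  refine ((measurePreserving_add_right volume
    ((1 - s) • WithLp.toLp 2 fun _ => (1 / 2 : ℝ))).quasiMeasurePreserving).comp
    (f := fun x : EuclideanSpace ℝ (Fin d) => s • x) ⟨by fun_prop, ?_⟩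
  rw [Measure.map_addHaar_smul volume hs.ne']
  exact Measure.smul_absolutelyContinuous

theorem ball_subset_of_mem_centeredCube {x : EuclideanSpace ℝ (Fin d)} (hx : x ∈ centeredCube d s)
    (r : ℝ) :
    Metric.ball x r ⊆ {z | ∀ i, z i ∈ Icc ((1 - s) / 2 - r) ((1 + s) / 2 + r)} := by
  intro z hz i
  have h1 := PiLp.norm_apply_le (z - x) i
  rw [Metric.mem_ball, dist_eq_norm] at hz
  rw [PiLp.sub_apply, Real.norm_eq_abs] at h1
  have h2 := abs_le.1 (h1.trans hz.le)
  have h3 := hx i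
  exact ⟨by linarith [h2.1, h3.1], by linarith [h2.2, h3.2]⟩

theorem isCompact_setOf_forall_mem_Icc (a b : ℝ) :
    IsCompact {z : EuclideanSpace ℝ (Fin d) | ∀ i, z i ∈ Icc a b} := by
  have h := (EuclideanSpace.equiv (Fin d) ℝ).toHomeomorph.isCompact_preimage.2
    (isCompact_univ_pi fun _ : Fin d => isCompact_Icc (a := a) (b := b))
  convert! h using 1
  ext z
  simp only [mem_ofPred_eq, mem_preimage, mem_univ_pi]
  rfl

theorem gaussIsopProfile_setIntegral_mollify_le (hE : MeasurableSet E) (hEsub : E ⊆ unitCube d)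
    (hfin : relPerimeter d E (unitCube d) < ⊤) (hs : 0 < s)
    (φ : ContDiffBump (0 : EuclideanSpace ℝ (Fin d))) (hφ : φ.rOut < (1 - s) / 2) :
    gaussIsopProfile (∫ x in unitCube d, mollify φ E (cubeDilation s x)) ≤
      (∫ x in unitCube d, gaussIsopProfile (mollify φ E (cubeDilation s x))) +
        (√(2 * π))⁻¹ * (s * (s ^ d)⁻¹ * (relPerimeter d E (unitCube d)).toReal) := by
  have hE' : volume E ≠ ⊤ :=
    ((measure_mono hEsub).trans_lt (by
      rw [← Measure.restrict_apply_univ]; exact measure_lt_top _ _)).ne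
  have hu := contDiff_mollify φ hE
  obtain ⟨C, hC⟩ := exists_norm_fderiv_mollify_le φ hE hE'
  have hfd : ∀ x, fderiv ℝ (fun x => mollify φ E (cubeDilation s x)) x =
      s • fderiv ℝ (mollify φ E) (cubeDilation s x) := by
    intro x
    have h1 : HasFDerivAt (cubeDilation s) (s • ContinuousLinearMap.id ℝ _) x :=
      ((hasFDerivAt_id x).const_smul s).add_const _
    refine (((hu.differentiable one_ne_zero)
      (cubeDilation s x)).hasFDerivAt.comp x h1).fderiv.trans ?_
    simp
  have hfn : ∀ x, ‖fderiv ℝ (fun x => mollify φ E (cubeDilation s x)) x‖ =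
      s * ‖fderiv ℝ (mollify φ E) (cubeDilation s x)‖ := fun x => by
    rw [hfd, norm_smul, Real.norm_of_nonneg hs.le]
  have hcd : ContDiff ℝ 1 fun x => mollify φ E (cubeDilation s x) :=
    hu.comp (by unfold cubeDilation; fun_prop)
  refine (gaussIsopProfile_setIntegral_unitCube_le hcd (fun x => mollify_mem_Icc φ hE _)
    (C := s * C) fun x => ?_).trans ?_
  · rw [hfn]
    exact mul_le_mul_of_nonneg_left (hC _) hs.le
  · simp_rw [hfn]
    rw [integral_const_mul, integral_comp_cubeDilation hs fun x => ‖fderiv ℝ (mollify φ E) x‖,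
      ← mul_assoc s]
    gcongr
    refine (ENNReal.ofReal_le_iff_le_toReal hfin.ne).1
      (setIntegral_norm_fderiv_mollify_le_relPerimeter φ hE hE' measurableSet_centeredCube
        (isCompact_setOf_forall_mem_Icc _ _) ?_
        fun x hx => ball_subset_of_mem_centeredCube hx φ.rOut)
    intro z hz i
    have := hz i
    exact ⟨by linarith [this.1], by linarith [this.2]⟩

theorem gaussIsopProfile_centeredCube_le (hE : MeasurableSet E) (hEsub : E ⊆ unitCube d)
    (hfin : relPerimeter d E (unitCube d) < ⊤) (hs : 0 < s) (hs1 : s < 1) :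
    gaussIsopProfile ((s ^ d)⁻¹ * volume.real (E ∩ centeredCube d s)) ≤
      (√(2 * π))⁻¹ * (s * (s ^ d)⁻¹ * (relPerimeter d E (unitCube d)).toReal) := by
  have hcI := continuous_gaussIsopProfile
  have hε : ∀ n : ℕ, 0 < (1 - s) / 2 * (1 / ((n : ℝ) + 1)) / 2 := fun n => by
    have := sub_pos.2 hs1
    positivity
  let φ : ℕ → ContDiffBump (0 : EuclideanSpace ℝ (Fin d)) := fun n =>
    ⟨(1 - s) / 2 * (1 / ((n : ℝ) + 1)) / 2 / 2, (1 - s) / 2 * (1 / ((n : ℝ) + 1)) / 2,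
      half_pos (hε n), half_lt_self (hε n)⟩
  have hlim : Tendsto (fun n => (φ n).rOut) atTop (𝓝 0) := by
    have := (tendsto_one_div_add_atTop_nhds_zero_nat (𝕜 := ℝ)).const_mul ((1 - s) / 2)
    simpa only [mul_zero, zero_div] using this.div_const 2
  have hae : ∀ᵐ x, Tendsto (fun n => mollify (φ n) E x) atTop
      (𝓝 (E.indicator (fun _ => (1 : ℝ)) x)) := by
    have := ContDiffBump.ae_convolution_tendsto_right_of_locallyIntegrable (μ := volume) (K := 2)
      hlim (Eventually.of_forall fun n => by simp only [φ]; linarith)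
      ((locallyIntegrable_const (1 : ℝ)).indicator hE)
    filter_upwards [this] with x hx
    simpa only [mollify, convolution_flip] using hx
  have hae' : ∀ᵐ x ∂volume.restrict (unitCube d),
      Tendsto (fun n => mollify (φ n) E (cubeDilation s x)) atTop
        (𝓝 (E.indicator (fun _ => (1 : ℝ)) (cubeDilation s x))) :=
    ae_restrict_of_ae ((quasiMeasurePreserving_cubeDilation hs).ae hae)
  have hcm : ∀ n, Measurable fun x => mollify (φ n) E (cubeDilation s x) := fun n =>
    (contDiff_mollify (φ n) hE).continuous.measurable.comp (measurable_cubeDilation s)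
  have h1 : Tendsto (fun n => ∫ x in unitCube d, mollify (φ n) E (cubeDilation s x)) atTop
      (𝓝 (∫ x in unitCube d, E.indicator (fun _ => (1 : ℝ)) (cubeDilation s x))) :=
    tendsto_integral_of_dominated_convergence (fun _ => 1)
      (fun n => (hcm n).aestronglyMeasurable) (integrable_const 1)
      (fun n => ae_of_all _ fun x => by
        rw [Real.norm_of_nonneg (mollify_mem_Icc _ hE _).1]
        exact (mollify_mem_Icc _ hE _).2) hae'
  have h2 : Tendsto (fun n => ∫ x in unitCube d, gaussIsopProfile (mollify (φ n) E
      (cubeDilation s x))) atTop (𝓝 (∫ x in unitCube d, gaussIsopProfile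
        (E.indicator (fun _ => (1 : ℝ)) (cubeDilation s x)))) :=
    tendsto_integral_of_dominated_convergence (fun _ => 1)
      (fun n => (hcI.measurable.comp (hcm n)).aestronglyMeasurable) (integrable_const 1)
      (fun n => ae_of_all _ fun x => abs_gaussIsopProfile_le_one _)
      (hae'.mono fun x hx => (hcI.tendsto _).comp hx)
  have h0 : ∀ x, gaussIsopProfile (E.indicator (fun _ => (1 : ℝ)) x) = 0 := fun x => by
    by_cases hx : x ∈ E <;> simp [hx, gaussIsopProfile]
  have hI : ∫ x in unitCube d, E.indicator (fun _ => (1 : ℝ)) (cubeDilation s x) =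
      (s ^ d)⁻¹ * volume.real (E ∩ centeredCube d s) := by
    rw [integral_comp_cubeDilation hs, integral_indicator hE, Measure.restrict_restrict hE]
    simp
  simp_rw [h0, integral_zero] at h2
  rw [hI] at h1
  refine le_of_tendsto_of_tendsto ((hcI.tendsto _).comp h1)
    ((h2.add_const _).trans_eq (by rw [zero_add])) (Eventually.of_forall fun n =>
      gaussIsopProfile_setIntegral_mollify_le hE hEsub hfin hs (φ n) ?_)
  have : 1 / ((n : ℝ) + 1) ≤ 1 := by
    rw [div_le_one (by positivity)]; linarith [Nat.cast_nonneg (α := ℝ) n]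
  have := hε n
  simp only [φ]
  nlinarith

theorem tendsto_volume_inter_centeredCube (hEsub : E ⊆ unitCube d) :
    Tendsto (fun s : ℝ => (s ^ d)⁻¹ * volume.real (E ∩ centeredCube d s)) (𝓝[<] 1)
      (𝓝 (volume.real E)) := by
  have hQ : volume.real (unitCube d) = 1 := by
    rw [measureReal_def, ← Measure.restrict_apply_univ, measure_univ, ENNReal.toReal_one]
  have hfin : volume (unitCube d) ≠ ⊤ := fun h => by simp [measureReal_def, h] at hQ
  have hEfin : volume E ≠ ⊤ := ((measure_mono hEsub).trans_lt hfin.lt_top).ne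
  have hinv : ContinuousAt (fun s : ℝ => (s ^ d)⁻¹) 1 := by
    refine ContinuousAt.inv₀ (by fun_prop) (by simp)
  have hlow : Tendsto (fun s : ℝ => (s ^ d)⁻¹ * (volume.real E - (1 - s ^ d))) (𝓝[<] 1)
      (𝓝 (volume.real E)) := by
    have : ContinuousAt (fun s : ℝ => (s ^ d)⁻¹ * (volume.real E - (1 - s ^ d))) 1 := by
      fun_prop
    simpa using this.tendsto.mono_left nhdsWithin_le_nhds
  have hup : Tendsto (fun s : ℝ => (s ^ d)⁻¹ * volume.real E) (𝓝[<] 1)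
      (𝓝 (volume.real E)) := by
    have : ContinuousAt (fun s : ℝ => (s ^ d)⁻¹ * volume.real E) 1 := by fun_prop
    simpa using this.tendsto.mono_left nhdsWithin_le_nhds
  refine tendsto_of_tendsto_of_tendsto_of_le_of_le' hlow hup ?_ ?_
  · filter_upwards [self_mem_nhdsWithin, nhdsWithin_le_nhds (lt_mem_nhds one_pos)] with s hs1 hs
    rw [mem_Iio] at hs1
    refine mul_le_mul_of_nonneg_left ?_ (by positivity)
    have hK : volume.real (centeredCube d s) = s ^ d := by
      have := integral_comp_cubeDilation (d := d) hs fun _ => 1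
      simp only [integral_const, measureReal_restrict_apply_univ, smul_eq_mul, mul_one, hQ] at this
      field_simp at this
      exact this.symm
    have hKQ : centeredCube d s ⊆ unitCube d := fun x hx i =>
      ⟨by linarith [(hx i).1], by linarith [(hx i).2]⟩
    have h1 := measureReal_inter_add_sdiff (μ := volume) (s := E)
      (measurableSet_centeredCube (s := s)) hEfin
    have h2 : volume.real (E \ centeredCube d s) ≤ volume.real (unitCube d \ centeredCube d s) :=
      measureReal_mono (sdiff_subset_sdiff_left hEsub)
        ((measure_mono sdiff_subset).trans_lt hfin.lt_top).ne
    rw [measureReal_sdiff hKQ measurableSet_centeredCube, hQ, hK] at h2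
    linarith
  · filter_upwards [nhdsWithin_le_nhds (lt_mem_nhds one_pos)] with s hs
    refine mul_le_mul_of_nonneg_left (measureReal_mono inter_subset_left hEfin) (by positivity)

end Dilation

/-- For every set of finite perimeter `E ⊆ (0,1)^d`,
`Per(E, (0,1)^d) ≥ √(2π) · I_γ(|E|)`. -/
theorem stmt6 (d : ℕ) (E : Set (EuclideanSpace ℝ (Fin d))) (hE : MeasurableSet E)
    (hEsub : E ⊆ unitCube d) (hfin : relPerimeter d E (unitCube d) < ⊤) :
    ENNReal.ofReal (Real.sqrt (2 * Real.pi) * gaussIsopProfile (volume E).toReal)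
      ≤ relPerimeter d E (unitCube d) := by
  have hinv : ContinuousAt (fun s : ℝ => (s ^ d)⁻¹) 1 :=
    ContinuousAt.inv₀ (by fun_prop) (by simp)
  have hup : Tendsto (fun s : ℝ => (√(2 * π))⁻¹ *
      (s * (s ^ d)⁻¹ * (relPerimeter d E (unitCube d)).toReal)) (𝓝[<] 1)
      (𝓝 ((√(2 * π))⁻¹ * (relPerimeter d E (unitCube d)).toReal)) := by
    have : ContinuousAt (fun s : ℝ => (√(2 * π))⁻¹ *
        (s * (s ^ d)⁻¹ * (relPerimeter d E (unitCube d)).toReal)) 1 := by fun_prop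
    have h := this.tendsto.mono_left (nhdsWithin_le_nhds (s := Iio 1))
    simpa only [one_pow, inv_one, one_mul] using h
  have hle : gaussIsopProfile (volume.real E) ≤
      (√(2 * π))⁻¹ * (relPerimeter d E (unitCube d)).toReal := by
    refine le_of_tendsto_of_tendsto ((continuous_gaussIsopProfile.tendsto _).comp
      (tendsto_volume_inter_centeredCube hEsub)) hup ?_
    filter_upwards [self_mem_nhdsWithin, nhdsWithin_le_nhds (lt_mem_nhds one_pos)] with s hs1 hs
    exact gaussIsopProfile_centeredCube_le hE hEsub hfin hs hs1
  refine ENNReal.ofReal_le_of_le_toReal ?_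
  rwa [← le_inv_mul_iff₀ (by positivity)]
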